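/- arXiv:1005.4583 — 2 statements merged into one kernel-verified Lean document; each statement's English description precedes it below -/
import Mathlib

section
/- For every integer n ≥ 1 there exists a bijection Ψ : S_n → S_n such that for all σ∈S_n: res σ = nest* Ψ(σ), les σ = cros* Ψ(σ), and des σ = drop* Ψ(σ) − 1. -/
open scoped Classical
open Finset

noncomputable section

namespace SZpaper

/-- `σ` as a 1-indexed function on `[1,n]`, extended by `0` elsewhere
(boundary convention `σ(0)=σ(n+1)=0`). -/
def pext (n : ℕ) (σ : Equiv.Perm (Fin n)) (i : ℕ) : ℕ :=
  if h : 1 ≤ i ∧ i ≤ n then ((σ ⟨i - 1, by omega⟩ : Fin n) : ℕ) + 1 else 0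

/-- `σ` extended with the Brändén boundary convention `σ(0)=σ(n+1)=n+1`. -/
def pextB (n : ℕ) (σ : Equiv.Perm (Fin n)) (i : ℕ) : ℕ :=
  if h : 1 ≤ i ∧ i ≤ n then ((σ ⟨i - 1, by omega⟩ : Fin n) : ℕ) + 1 else n + 1

/-- `σ` extended with the boundary convention `σ(0)=0`, `σ(n+1)=n+1`. -/
def pextC (n : ℕ) (σ : Equiv.Perm (Fin n)) (i : ℕ) : ℕ :=
  if h : 1 ≤ i ∧ i ≤ n then ((σ ⟨i - 1, by omega⟩ : Fin n) : ℕ) + 1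
  else if i = 0 then 0 else n + 1

/-- The set of pairs `(i,j)` with `i, j ∈ [1,n]`. -/
def pairs (n : ℕ) : Finset (ℕ × ℕ) := Finset.Icc 1 n ×ˢ Finset.Icc 1 n

/-- `des σ = #{i ∈ [n−1] : σ(i) > σ(i+1)}`. -/
def desStat (n : ℕ) (σ : Equiv.Perm (Fin n)) : ℕ :=
  ((Finset.Icc 1 (n - 1)).filter fun i => pext n σ (i + 1) < pext n σ i).card

/-- `les σ = #{(i,j) : 2 ≤ i < j ≤ n, σ(i−1) > σ(j) > σ(i)}`. -/
def lesStat (n : ℕ) (σ : Equiv.Perm (Fin n)) : ℕ :=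
  ((pairs n).filter fun x => 2 ≤ x.1 ∧ x.1 < x.2 ∧
    pext n σ x.1 < pext n σ x.2 ∧ pext n σ x.2 < pext n σ (x.1 - 1)).card

/-- `less σ = #{(i,j) : 2 ≤ i < j ≤ n, σ(i−1) < σ(j) < σ(i)}`. -/
def lessStat (n : ℕ) (σ : Equiv.Perm (Fin n)) : ℕ :=
  ((pairs n).filter fun x => 2 ≤ x.1 ∧ x.1 < x.2 ∧
    pext n σ (x.1 - 1) < pext n σ x.2 ∧ pext n σ x.2 < pext n σ x.1).card

/-- `res σ = #{(i,j) : 1 ≤ i < j ≤ n−1, σ(j+1) > σ(i) > σ(j)}`. -/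
def resStat (n : ℕ) (σ : Equiv.Perm (Fin n)) : ℕ :=
  ((pairs n).filter fun x => x.1 < x.2 ∧ x.2 ≤ n - 1 ∧
    pext n σ x.2 < pext n σ x.1 ∧ pext n σ x.1 < pext n σ (x.2 + 1)).card

/-- `ress σ = #{(i,j) : 1 ≤ i < j ≤ n−1, σ(j+1) < σ(i) < σ(j)}`. -/
def ressStat (n : ℕ) (σ : Equiv.Perm (Fin n)) : ℕ :=
  ((pairs n).filter fun x => x.1 < x.2 ∧ x.2 ≤ n - 1 ∧
    pext n σ (x.2 + 1) < pext n σ x.1 ∧ pext n σ x.1 < pext n σ x.2).card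

/-! Linear statistics with the boundary convention `σ(0)=σ(n+1)=0` (starred). -/

def peakStar (n : ℕ) (σ : Equiv.Perm (Fin n)) : ℕ :=
  ((Finset.Icc 1 n).filter fun i =>
    pext n σ (i - 1) < pext n σ i ∧ pext n σ (i + 1) < pext n σ i).card

def valleyStar (n : ℕ) (σ : Equiv.Perm (Fin n)) : ℕ :=
  ((Finset.Icc 1 n).filter fun i =>
    pext n σ i < pext n σ (i - 1) ∧ pext n σ i < pext n σ (i + 1)).card

def daStar (n : ℕ) (σ : Equiv.Perm (Fin n)) : ℕ :=
  ((Finset.Icc 1 n).filter fun i =>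
    pext n σ (i - 1) < pext n σ i ∧ pext n σ i < pext n σ (i + 1)).card

def ddStar (n : ℕ) (σ : Equiv.Perm (Fin n)) : ℕ :=
  ((Finset.Icc 1 n).filter fun i =>
    pext n σ (i + 1) < pext n σ i ∧ pext n σ i < pext n σ (i - 1)).card

/-! Linear statistics with the Brändén boundary convention `σ(0)=σ(n+1)=n+1`. -/

def peakB (n : ℕ) (σ : Equiv.Perm (Fin n)) : ℕ :=
  ((Finset.Icc 1 n).filter fun i =>
    pextB n σ (i - 1) < pextB n σ i ∧ pextB n σ (i + 1) < pextB n σ i).card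

def valleyB (n : ℕ) (σ : Equiv.Perm (Fin n)) : ℕ :=
  ((Finset.Icc 1 n).filter fun i =>
    pextB n σ i < pextB n σ (i - 1) ∧ pextB n σ i < pextB n σ (i + 1)).card

def daB (n : ℕ) (σ : Equiv.Perm (Fin n)) : ℕ :=
  ((Finset.Icc 1 n).filter fun i =>
    pextB n σ (i - 1) < pextB n σ i ∧ pextB n σ i < pextB n σ (i + 1)).card

def ddB (n : ℕ) (σ : Equiv.Perm (Fin n)) : ℕ :=
  ((Finset.Icc 1 n).filter fun i =>
    pextB n σ (i + 1) < pextB n σ i ∧ pextB n σ i < pextB n σ (i - 1)).card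

/-! Linear statistics with the boundary convention `σ(0)=0`, `σ(n+1)=n+1`. -/

def valleyC (n : ℕ) (σ : Equiv.Perm (Fin n)) : ℕ :=
  ((Finset.Icc 1 n).filter fun i =>
    pextC n σ i < pextC n σ (i - 1) ∧ pextC n σ i < pextC n σ (i + 1)).card

def daC (n : ℕ) (σ : Equiv.Perm (Fin n)) : ℕ :=
  ((Finset.Icc 1 n).filter fun i =>
    pextC n σ (i - 1) < pextC n σ i ∧ pextC n σ i < pextC n σ (i + 1)).card

def ddC (n : ℕ) (σ : Equiv.Perm (Fin n)) : ℕ :=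
  ((Finset.Icc 1 n).filter fun i =>
    pextC n σ (i + 1) < pextC n σ i ∧ pextC n σ i < pextC n σ (i - 1)).card

/-- `fmax σ`: the number of double ascents (convention `σ(0)=0`, `σ(n+1)=n+1`)
which are left-to-right maxima. -/
def fmaxStat (n : ℕ) (σ : Equiv.Perm (Fin n)) : ℕ :=
  ((Finset.Icc 1 n).filter fun i =>
    pextC n σ (i - 1) < pextC n σ i ∧ pextC n σ i < pextC n σ (i + 1) ∧
    ∀ j ∈ Finset.Ico 1 i, pext n σ j < pext n σ i).card

/-! Cyclic statistics. -/

def excStat (n : ℕ) (σ : Equiv.Perm (Fin n)) : ℕ :=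
  ((Finset.Icc 1 n).filter fun i => i < pext n σ i).card

def wexStat (n : ℕ) (σ : Equiv.Perm (Fin n)) : ℕ :=
  ((Finset.Icc 1 n).filter fun i => i ≤ pext n σ i).card

def dropStat (n : ℕ) (σ : Equiv.Perm (Fin n)) : ℕ :=
  ((Finset.Icc 1 n).filter fun i => pext n σ i < i).card

def fixStat (n : ℕ) (σ : Equiv.Perm (Fin n)) : ℕ :=
  ((Finset.Icc 1 n).filter fun i => pext n σ i = i).card

/-- cyclic valleys: `x` with `σ⁻¹(x) > x < σ(x)`. -/
def cvalleyStat (n : ℕ) (σ : Equiv.Perm (Fin n)) : ℕ :=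
  ((Finset.Icc 1 n).filter fun x => x < pext n σ⁻¹ x ∧ x < pext n σ x).card

/-- double excedances: `x` with `σ⁻¹(x) < x < σ(x)`. -/
def cdaStat (n : ℕ) (σ : Equiv.Perm (Fin n)) : ℕ :=
  ((Finset.Icc 1 n).filter fun x => pext n σ⁻¹ x < x ∧ x < pext n σ x).card

/-- double drops: `x` with `σ⁻¹(x) > x > σ(x)`. -/
def cddStat (n : ℕ) (σ : Equiv.Perm (Fin n)) : ℕ :=
  ((Finset.Icc 1 n).filter fun x => x < pext n σ⁻¹ x ∧ pext n σ x < x).card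

/-- crossings. -/
def crosStat (n : ℕ) (σ : Equiv.Perm (Fin n)) : ℕ :=
  ((pairs n).filter fun x =>
    (x.1 < x.2 ∧ x.2 ≤ pext n σ x.1 ∧ pext n σ x.1 < pext n σ x.2) ∨
    (x.2 < x.1 ∧ pext n σ x.1 < x.2 ∧ pext n σ x.2 < pext n σ x.1)).card

/-- nestings. -/
def nestStat (n : ℕ) (σ : Equiv.Perm (Fin n)) : ℕ :=
  ((pairs n).filter fun x =>
    (x.1 < x.2 ∧ x.2 ≤ pext n σ x.2 ∧ pext n σ x.2 < pext n σ x.1) ∨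
    (x.2 < x.1 ∧ pext n σ x.2 < x.2 ∧ pext n σ x.1 < pext n σ x.2)).card

/-- number of cycles of `σ` (fixed points count as cycles). -/
def cycStat (n : ℕ) (σ : Equiv.Perm (Fin n)) : ℕ :=
  Multiset.card σ.cycleType + (Finset.univ.filter fun x => σ x = x).card

/-! Star statistics: `σ*(i) = σ(i) − 1`, a bijection `[n] → {0,…,n−1}`;
we extend `σ*` by `0` outside `[1,n]`. -/

def starf (n : ℕ) (σ : Equiv.Perm (Fin n)) (i : ℕ) : ℕ :=
  if 1 ≤ i ∧ i ≤ n then pext n σ i - 1 else 0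

/-- `(σ*)⁻¹(i) = σ⁻¹(i+1)`, defined for `0 ≤ i ≤ n−1`. -/
def invstarf (n : ℕ) (σ : Equiv.Perm (Fin n)) (i : ℕ) : ℕ :=
  pext n σ⁻¹ (i + 1)

def dropStarStat (n : ℕ) (σ : Equiv.Perm (Fin n)) : ℕ :=
  ((Finset.Icc 1 n).filter fun i => starf n σ i < i).card

def fixStarStat (n : ℕ) (σ : Equiv.Perm (Fin n)) : ℕ :=
  ((Finset.Icc 1 n).filter fun i => starf n σ i = i).card

def wexStarStat (n : ℕ) (σ : Equiv.Perm (Fin n)) : ℕ :=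
  ((Finset.Icc 1 n).filter fun i => i ≤ starf n σ i).card

def cdaStarStat (n : ℕ) (σ : Equiv.Perm (Fin n)) : ℕ :=
  ((Finset.Icc 1 n).filter fun i => invstarf n σ i < i ∧ i < starf n σ i).card

def cddStarStat (n : ℕ) (σ : Equiv.Perm (Fin n)) : ℕ :=
  ((Finset.Icc 1 n).filter fun i => i < invstarf n σ i ∧ starf n σ i < i).card

def cvalleyStarStat (n : ℕ) (σ : Equiv.Perm (Fin n)) : ℕ :=
  ((Finset.Icc 1 n).filter fun i => i < invstarf n σ i ∧ i < starf n σ i).card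

def crosStarStat (n : ℕ) (σ : Equiv.Perm (Fin n)) : ℕ :=
  ((pairs n).filter fun x =>
    (x.1 < x.2 ∧ x.2 ≤ starf n σ x.1 ∧ starf n σ x.1 < starf n σ x.2) ∨
    (x.2 < x.1 ∧ starf n σ x.1 < x.2 ∧ starf n σ x.2 < starf n σ x.1)).card

def nestStarStat (n : ℕ) (σ : Equiv.Perm (Fin n)) : ℕ :=
  ((pairs n).filter fun x =>
    (x.1 < x.2 ∧ x.2 ≤ starf n σ x.2 ∧ starf n σ x.2 < starf n σ x.1) ∨
    (x.2 < x.1 ∧ starf n σ x.2 < x.2 ∧ starf n σ x.1 < starf n σ x.2)).card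

/-- `cyc* σ`: the number of cycles of the functional digraph of `σ*` on `[n]`,
counted as the number of `i ∈ [1,n]` that lie on a cycle of `σ*` and are
minimal in their cycle. (The component of `σ*` that is a path from `n` to `0`
contributes no such `i`.) -/
def cycStarStat (n : ℕ) (σ : Equiv.Perm (Fin n)) : ℕ :=
  ((Finset.Icc 1 n).filter fun i =>
    (∃ m ∈ Finset.Icc 1 n, (starf n σ)^[m] i = i) ∧
    ∀ m ∈ Finset.range (n + 1), i ≤ (starf n σ)^[m] i).card

/-! Motzkin paths, encoded as step sequences `γ : Fin m → Fin 3`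
(`0` = up step `(1,1)`, `1` = level step `(1,0)`, `2` = down step `(1,−1)`). -/

/-- The height (ordinate) of the path after `i` steps. -/
def hgt (m : ℕ) (γ : Fin m → Fin 3) (i : ℕ) : ℤ :=
  ∑ j ∈ Finset.range i, if hj : j < m then 1 - ((γ ⟨j, hj⟩ : ℕ) : ℤ) else 0

/-- A step sequence is a Motzkin path if it never goes below the x-axis and
ends at height `0`. -/
def IsMotzkin (m : ℕ) (γ : Fin m → Fin 3) : Prop :=
  (∀ i ≤ m, 0 ≤ hgt m γ i) ∧ hgt m γ m = 0

/-- The (finite) set of Motzkin paths of length `m`. -/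
def motzkin (m : ℕ) : Finset (Fin m → Fin 3) :=
  Finset.univ.filter fun γ => IsMotzkin m γ

/-- number of up (North-East) steps. -/
def neCount (m : ℕ) (γ : Fin m → Fin 3) : ℕ :=
  (Finset.univ.filter fun i => γ i = 0).card

/-- number of level (East) steps. -/
def eCount (m : ℕ) (γ : Fin m → Fin 3) : ℕ :=
  (Finset.univ.filter fun i => γ i = 1).card

/-- the `(p,q)`-integer `[m]_{p,q} = p^{m−1} + p^{m−2}q + ⋯ + q^{m−1}`. -/
def pqInt {R : Type*} [CommRing R] (p q : R) (m : ℕ) : R :=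
  ∑ j ∈ Finset.range m, p ^ (m - 1 - j) * q ^ j

/-! Cyclic side: building a bijection with prescribed drops and crossing numbers. -/

theorem exists_mem_card_filter_lt (S : Finset ℕ) (c : ℕ) (hc : c < #S) :
    ∃ b ∈ S, #{y ∈ S | b < y} = c := by
  induction S using Finset.induction_on_min generalizing c with
  | empty => simp at hc
  | insert a s ha ih =>
    have has : a ∉ s := fun h => lt_irrefl _ (ha a h)
    rw [card_insert_of_notMem has] at hc
    rcases Nat.lt_succ_iff_lt_or_eq.mp hc with h | h
    · obtain ⟨b, hb, hbc⟩ := ih c h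
      refine ⟨b, mem_insert_of_mem hb, ?_⟩
      rw [filter_insert, if_neg (not_lt.mpr (ha b hb).le), hbc]
    · refine ⟨a, mem_insert_self _ _, ?_⟩
      rw [filter_insert, if_neg (lt_irrefl a), filter_true_of_mem ha, h]

theorem exists_injOn_drop (A B : Finset ℕ) (c : ℕ → ℕ) (hcard : #A = #B)
    (h : ∀ k ∈ A, c k + #{i ∈ A | i < k} < #{b ∈ B | b < k}) :
    ∃ f : ℕ → ℕ, (∀ k ∈ A, f k ∈ B ∧ f k < k) ∧ Set.InjOn f A ∧
      ∀ k ∈ A, #{i ∈ A | k < i ∧ f i < k ∧ f k < f i} = c k := by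
  induction A using Finset.induction_on_min generalizing B with
  | empty => exact ⟨id, by simp, by simp, by simp⟩
  | insert a s ha ih =>
    have has : a ∉ s := fun h => lt_irrefl _ (ha a h)
    have h1 := h a (mem_insert_self _ _)
    obtain ⟨b, hb, hbc⟩ := exists_mem_card_filter_lt {b ∈ B | b < a} (c a) (by omega)
    simp only [mem_filter] at hb
    rw [card_insert_of_notMem has] at hcard
    obtain ⟨f, hf, hinj, hcr⟩ := ih (B.erase b) (by rw [card_erase_of_mem hb.1]; omega) (by
      intro k hk
      have h2 := h k (mem_insert_of_mem hk)
      rw [filter_insert, if_pos (ha k hk), card_insert_of_notMem (by simp [has])] at h2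
      rw [filter_erase, card_erase_of_mem (by simp [hb.1, hb.2.trans (ha k hk)])]
      omega)
    have hne : ∀ k ∈ s, k ≠ a := fun k hk e => has (e ▸ hk)
    have hfne : ∀ k ∈ s, f k ≠ b := fun k hk => (mem_erase.mp (hf k hk).1).1
    have himg : s.image f = B.erase b := by
      apply eq_of_subset_of_card_le
      · intro x hx
        obtain ⟨k, hk, rfl⟩ := mem_image.mp hx
        exact (hf k hk).1
      · rw [card_image_of_injOn hinj, card_erase_of_mem hb.1]; omega
    refine ⟨Function.update f a b, ?_, ?_, ?_⟩
    · intro k hk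
      rcases mem_insert.mp hk with rfl | hk
      · simpa using hb
      · rw [Function.update_of_ne (hne k hk)]
        exact ⟨mem_of_mem_erase (hf k hk).1, (hf k hk).2⟩
    · intro x hx y hy hxy
      rcases mem_insert.mp hx with hxa | hxs <;> rcases mem_insert.mp hy with hya | hys
      · rw [hxa, hya]
      · rw [hxa, Function.update_self, Function.update_of_ne (hne y hys)] at hxy
        exact absurd hxy.symm (hfne y hys)
      · rw [hya, Function.update_self, Function.update_of_ne (hne x hxs)] at hxy
        exact absurd hxy (hfne x hxs)
      · rw [Function.update_of_ne (hne x hxs), Function.update_of_ne (hne y hys)] at hxy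
        exact hinj hxs hys hxy
    · intro k hk
      rcases mem_insert.mp hk with rfl | hk
      · rw [Function.update_self, ← hbc]
        apply card_bij (fun i _ => f i)
        · intro i hi
          simp only [mem_filter, mem_insert] at hi ⊢
          have his : i ∈ s := hi.1.resolve_left (by omega)
          rw [Function.update_of_ne (hne i his)] at hi
          exact ⟨⟨mem_of_mem_erase (hf i his).1, hi.2.2.1⟩, hi.2.2.2⟩
        · intro i hi j hj hij
          simp only [mem_filter, mem_insert] at hi hj
          exact hinj (hi.1.resolve_left (by omega)) (hj.1.resolve_left (by omega)) hij
        · intro y hy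
          simp only [mem_filter] at hy
          have : y ∈ s.image f := by rw [himg, mem_erase]; exact ⟨by omega, hy.1.1⟩
          obtain ⟨i, hi, rfl⟩ := mem_image.mp this
          refine ⟨i, ?_, rfl⟩
          simp only [mem_filter, mem_insert]
          rw [Function.update_of_ne (hne i hi)]
          exact ⟨Or.inr hi, ha i hi, hy.1.2, hy.2⟩
      · rw [← hcr k hk, filter_insert, if_neg (by have := ha k hk; omega),
          Function.update_of_ne (hne k hk)]
        congr 1
        apply filter_congr
        intro i hi
        rw [Function.update_of_ne (hne i hi)]

/-- The number of crossings whose second index is `k`. -/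
def crosAt (n : ℕ) (F : ℕ → ℕ) (k : ℕ) : ℕ :=
  #{i ∈ Icc 1 n | (i < k ∧ k ≤ F i ∧ F i < F k) ∨ (k < i ∧ F i < k ∧ F k < F i)}

/-- The number of nestings whose second index is `k`. -/
def nestAt (n : ℕ) (F : ℕ → ℕ) (k : ℕ) : ℕ :=
  #{i ∈ Icc 1 n | (i < k ∧ k ≤ F k ∧ F k < F i) ∨ (k < i ∧ F k < k ∧ F i < F k)}

theorem card_filter_lt_add_card_filter_ge (s : Finset ℕ) (k : ℕ) :
    #{i ∈ s | i < k} + #{i ∈ s | k ≤ i} = #s := by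
  rw [← card_filter_add_card_filter_not (s := s) (fun i => i < k)]
  simp only [not_lt]

theorem exists_crosAt_eq (n : ℕ) (A B : Finset ℕ) (c : ℕ → ℕ) (hA : A ⊆ Icc 1 n)
    (hB : B ⊆ range n) (hcard : #A = #B)
    (h : ∀ k ∈ Icc 1 n, c k + #{i ∈ A | i < k} < #{b ∈ B | b < k}) :
    ∃ F : ℕ → ℕ, (∀ k ∈ Icc 1 n, F k < n) ∧ Set.InjOn F (Icc 1 n) ∧
      (∀ k ∈ Icc 1 n, k ∈ A ↔ F k < k) ∧ (∀ k ∈ A, F k ∈ B) ∧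
      ∀ k ∈ Icc 1 n, crosAt n F k = c k := by
  obtain ⟨f, hf, hfi, hfc⟩ := exists_injOn_drop A B c hcard (fun k hk => h k (hA hk))
  obtain ⟨g, hg, hgi, hgc⟩ := exists_injOn_drop
      ((Icc 1 n \ A).image (fun i => n + 1 - i)) ((range n \ B).image (fun i => n - i))
      (fun k => c (n + 1 - k)) (by
        rw [card_image_of_injOn, card_image_of_injOn, card_sdiff_of_subset hA,
          card_sdiff_of_subset hB, hcard]
        · simp
        · intro x hx y hy hxy
          simp at hx hy hxy
          omega
        · intro x hx y hy hxy
          simp at hx hy hxy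
          omega) (by
        intro k' hk'
        obtain ⟨k, hk, rfl⟩ := mem_image.mp hk'
        simp only [mem_sdiff, mem_Icc] at hk
        have hkk : n + 1 - (n + 1 - k) = k := by omega
        have h1 := h k (by simpa using hk.1)
        have e1 : #{i ∈ (Icc 1 n \ A).image (fun i => n + 1 - i) | i < n + 1 - k} =
            #({i ∈ Icc 1 n | k < i} \ {i ∈ A | k < i}) := by
          symm
          apply card_bij (fun i _ => n + 1 - i)
          · intro i hi
            simp only [mem_sdiff, mem_filter, mem_image, mem_Icc] at hi ⊢
            exact ⟨⟨i, ⟨hi.1.1, fun hh => hi.2 ⟨hh, hi.1.2⟩⟩, rfl⟩, by omega⟩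
          · intro i hi j hj hij
            simp only [mem_sdiff, mem_filter, mem_Icc] at hi hj
            omega
          · intro y hy
            simp only [mem_sdiff, mem_filter, mem_image, mem_Icc] at hy
            obtain ⟨⟨i, hi, rfl⟩, hik⟩ := hy
            refine ⟨i, ?_, rfl⟩
            simp only [mem_sdiff, mem_filter, mem_Icc]
            exact ⟨⟨hi.1, by omega⟩, fun hh => hi.2 hh.1⟩
        have e2 : #{i ∈ (range n \ B).image (fun i => n - i) | i < n + 1 - k} =
            #({i ∈ range n | k ≤ i} \ {i ∈ B | k ≤ i}) := by
          symm
          apply card_bij (fun i _ => n - i)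
          · intro i hi
            simp only [mem_sdiff, mem_filter, mem_image, mem_range] at hi ⊢
            exact ⟨⟨i, ⟨hi.1.1, fun hh => hi.2 ⟨hh, hi.1.2⟩⟩, rfl⟩, by omega⟩
          · intro i hi j hj hij
            simp only [mem_sdiff, mem_filter, mem_range] at hi hj
            omega
          · intro y hy
            simp only [mem_sdiff, mem_filter, mem_image, mem_range] at hy
            obtain ⟨⟨i, hi, rfl⟩, hik⟩ := hy
            refine ⟨i, ?_, rfl⟩
            simp only [mem_sdiff, mem_filter, mem_range]
            exact ⟨⟨hi.1, by omega⟩, fun hh => hi.2 hh.1⟩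
        rw [e1, e2, hkk, card_sdiff_of_subset (filter_subset_filter _ hA),
          card_sdiff_of_subset (filter_subset_filter _ hB)]
        have e3 : #{i ∈ Icc 1 n | k < i} = n - k := by
          rw [show ({i ∈ Icc 1 n | k < i} : Finset ℕ) = Ioc k n by
            ext; simp only [mem_filter, mem_Icc, mem_Ioc]; omega, Nat.card_Ioc]
        have e4 : #{i ∈ range n | k ≤ i} = n - k := by
          rw [show ({i ∈ range n | k ≤ i} : Finset ℕ) = Ico k n by
            ext; simp only [mem_filter, mem_range, mem_Ico]; omega, Nat.card_Ico]
        have e5 := card_filter_lt_add_card_filter_ge A k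
        have e6 := card_filter_lt_add_card_filter_ge B k
        have e7 : ({i ∈ A | k ≤ i} : Finset ℕ) = {i ∈ A | k < i} := by
          apply filter_congr
          intro i hi
          have : i ≠ k := fun e => hk.2 (e ▸ hi)
          omega
        rw [e7] at e5
        have e8 : #{i ∈ A | k < i} ≤ n - k := e3 ▸ card_le_card (filter_subset_filter _ hA)
        have e9 : #{i ∈ B | k ≤ i} ≤ n - k := e4 ▸ card_le_card (filter_subset_filter _ hB)
        omega)
  have hgA : ∀ k ∈ Icc 1 n, k ∉ A → n + 1 - k ∈ (Icc 1 n \ A).image (fun i => n + 1 - i) :=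
    fun k hk hkA => mem_image_of_mem (fun i => n + 1 - i) (mem_sdiff.mpr ⟨hk, hkA⟩)
  have hgB : ∀ k ∈ Icc 1 n, k ∉ A → n - g (n + 1 - k) ∉ B ∧ n - g (n + 1 - k) < n ∧
      g (n + 1 - k) ≤ n ∧ k ≤ n - g (n + 1 - k) := by
    intro k hk hkA
    obtain ⟨h1, h2⟩ := hg _ (hgA k hk hkA)
    obtain ⟨v, hv, hvg⟩ := mem_image.mp h1
    simp only [mem_sdiff, mem_range, mem_Icc] at hv hk
    have : n - g (n + 1 - k) = v := by omega
    rw [this]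
    exact ⟨hv.2, hv.1, by omega, by omega⟩
  set F : ℕ → ℕ := fun k => if k ∈ A then f k else n - g (n + 1 - k) with hF
  have FA : ∀ k ∈ A, F k = f k := fun k hk => if_pos hk
  have FN : ∀ k, k ∉ A → F k = n - g (n + 1 - k) := fun k hk => if_neg hk
  have hlt : ∀ k ∈ Icc 1 n, k ∈ A ↔ F k < k := by
    intro k hk
    by_cases hkA : k ∈ A
    · simp [FA k hkA, hkA, (hf k hkA).2]
    · have := hgB k hk hkA
      simp only [FN k hkA, hkA, false_iff]
      omega
  refine ⟨F, ?_, ?_, hlt, ?_, ?_⟩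
  · intro k hk
    by_cases hkA : k ∈ A
    · rw [FA k hkA]; exact mem_range.mp (hB (hf k hkA).1)
    · rw [FN k hkA]; exact (hgB k hk hkA).2.1
  · intro x hx y hy hxy
    by_cases hxA : x ∈ A <;> by_cases hyA : y ∈ A
    · rw [FA x hxA, FA y hyA] at hxy; exact hfi hxA hyA hxy
    · rw [FA x hxA, FN y hyA] at hxy
      exact absurd (hxy ▸ (hf x hxA).1) (hgB y hy hyA).1
    · rw [FN x hxA, FA y hyA] at hxy
      exact absurd (hxy ▸ (hf y hyA).1) (hgB x hx hxA).1
    · rw [FN x hxA, FN y hyA] at hxy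
      have h1 := hgB x hx hxA
      have h2 := hgB y hy hyA
      have := hgi (hgA x hx hxA) (hgA y hy hyA) (by omega)
      simp only [coe_Icc, Set.mem_Icc] at hx hy
      omega
  · intro k hk; rw [FA k hk]; exact (hf k hk).1
  · intro k hk
    by_cases hkA : k ∈ A
    · rw [← hfc k hkA, crosAt]
      have h0 := (hlt k hk).mp hkA
      congr 1
      ext i
      simp only [mem_filter]
      constructor
      · rintro ⟨hi, h1⟩
        have hiA : i ∈ A := (hlt i hi).mpr (by omega)
        rw [FA i hiA, FA k hkA] at h1
        rw [FA k hkA] at h0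
        exact ⟨hiA, by omega⟩
      · rintro ⟨hiA, h1⟩
        rw [FA i hiA, FA k hkA]
        exact ⟨hA hiA, Or.inr h1⟩
    · have h0 := hgB k hk hkA
      have h1 := hgc _ (hgA k hk hkA)
      have hk' := mem_Icc.mp hk
      rw [show n + 1 - (n + 1 - k) = k by omega] at h1
      rw [← h1, crosAt]
      apply card_bij (fun i _ => n + 1 - i)
      · intro i hi
        obtain ⟨hi, h2⟩ := mem_filter.mp hi
        have hk2 := FN k hkA
        have hiA : i ∉ A := by rw [hlt i hi]; omega
        have hi2 := FN i hiA
        have h3 := hgB i hi hiA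
        have hi' := mem_Icc.mp hi
        exact mem_filter.mpr ⟨hgA i hi hiA, by omega⟩
      · intro i hi j hj hij
        have hi' := mem_Icc.mp (mem_filter.mp hi).1
        have hj' := mem_Icc.mp (mem_filter.mp hj).1
        omega
      · intro y hy
        obtain ⟨hy, h2⟩ := mem_filter.mp hy
        obtain ⟨i, hi, rfl⟩ := mem_image.mp hy
        obtain ⟨hi, hiA⟩ := mem_sdiff.mp hi
        have hi' := mem_Icc.mp hi
        have h3 := hgB i hi hiA
        have hk2 := FN k hkA
        have hi2 := FN i hiA
        exact ⟨i, mem_filter.mpr ⟨hi, by omega⟩, rfl⟩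

theorem crosAt_add_nestAt (n : ℕ) (F : ℕ → ℕ) (hFn : ∀ k ∈ Icc 1 n, F k < n)
    (hinj : Set.InjOn F (Icc 1 n)) (k : ℕ) (hk : k ∈ Icc 1 n) :
    crosAt n F k + nestAt n F k + 1 + #{i ∈ Icc 1 n | F i < i ∧ i < k} =
      #{i ∈ Icc 1 n | F i < i ∧ F i < k} := by
  have hk' := mem_Icc.mp hk
  have hne : ∀ i ∈ Icc 1 n, F i = F k → i = k := fun i hi h => hinj hi hk h
  have e0 : crosAt n F k + nestAt n F k =
      #{i ∈ Icc 1 n | (i < k ∧ k ≤ F i ∧ k ≤ F k) ∨ (k < i ∧ F i < k ∧ F k < k)} := by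
    rw [crosAt, nestAt, ← card_union_of_disjoint]
    · congr 1
      ext i
      simp only [mem_union, mem_filter, ← and_or_left]
      apply and_congr_right
      intro hi
      have := hne i hi
      omega
    · rw [disjoint_filter]
      intro i _
      omega
  rw [e0]
  by_cases hlt : F k < k
  · change _ + #({k} : Finset ℕ) + _ = _
    rw [← card_union_of_disjoint, ← card_union_of_disjoint]
    · congr 1
      ext i
      simp only [mem_union, mem_filter, mem_singleton]
      by_cases hik : i = k
      · subst hik; simp [hk, hlt]
      · simp only [hik, or_false, ← and_or_left]
        apply and_congr_right
        intro _
        omega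
    · rw [disjoint_left]
      intro i
      simp only [mem_union, mem_filter, mem_singleton]
      omega
    · rw [disjoint_left]
      intro i
      simp only [mem_filter, mem_singleton]
      omega
  · have himg : (Icc 1 n).image F = range n := by
      apply eq_of_subset_of_card_le
      · intro x hx
        obtain ⟨i, hi, rfl⟩ := mem_image.mp hx
        exact mem_range.mpr (hFn i hi)
      · rw [card_image_of_injOn hinj]; simp
    have e1 : #{i ∈ Icc 1 n | F i < k} = k := by
      rw [← card_image_of_injOn (f := F) (hinj.mono (coe_subset.mpr (filter_subset _ _))),
        ← filter_image (p := (· < k)), himg, show ({i ∈ range n | i < k} : Finset ℕ) = range k by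
          ext; simp only [mem_filter, mem_range]; omega, card_range]
    have e2 : #{i ∈ Icc 1 n | i < k} = k - 1 := by
      rw [show ({i ∈ Icc 1 n | i < k} : Finset ℕ) = Ico 1 k by
          ext; simp only [mem_filter, mem_Icc, mem_Ico]; omega, Nat.card_Ico]
    rw [← card_filter_add_card_filter_not (fun i => i < k), filter_filter, filter_filter] at e1
    rw [← card_filter_add_card_filter_not (fun i => F i < k), filter_filter, filter_filter] at e2
    rw [← card_filter_add_card_filter_not (s := {i ∈ Icc 1 n | F i < i ∧ F i < k})
      (fun i => i < k), filter_filter, filter_filter]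
    have c1 : ({i ∈ Icc 1 n | (i < k ∧ k ≤ F i ∧ k ≤ F k) ∨ (k < i ∧ F i < k ∧ F k < k)} :
        Finset ℕ) = {i ∈ Icc 1 n | i < k ∧ ¬ F i < k} := filter_congr (by intros; omega)
    have c2 : ({i ∈ Icc 1 n | (F i < i ∧ F i < k) ∧ i < k} : Finset ℕ) =
        {i ∈ Icc 1 n | F i < i ∧ i < k} := filter_congr (by intros; omega)
    have c3 : ({i ∈ Icc 1 n | (F i < i ∧ F i < k) ∧ ¬ i < k} : Finset ℕ) =
        {i ∈ Icc 1 n | F i < k ∧ ¬ i < k} := filter_congr (by intros; omega)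
    have c4 : ({i ∈ Icc 1 n | F i < k ∧ i < k} : Finset ℕ) =
        {i ∈ Icc 1 n | i < k ∧ F i < k} := filter_congr (by intros; omega)
    rw [c1, c2, c3]
    rw [c4] at e1
    omega

/-! Linear side: a word is determined by its descent tops, its descent bottoms and the numbers
of descents to the left of `k` that span `k`. -/

/-- `w` is a permutation of `[1,n]` extended by `w 0 = w (n+1) = 0`, and `p` is its inverse
`[0,n] → [1,n+1]`. -/
structure IsWord (n : ℕ) (w p : ℕ → ℕ) : Prop where
  w_zero : w 0 = 0
  w_last : w (n + 1) = 0
  w_le : ∀ i, w i ≤ n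
  one_le_p : ∀ v ≤ n, 1 ≤ p v
  p_le : ∀ v ≤ n, p v ≤ n + 1
  w_p : ∀ v ≤ n, w (p v) = v
  p_w : ∀ i, 1 ≤ i → i ≤ n + 1 → p (w i) = i

/-- The values below `k` that are immediately preceded by a value at least `k`. -/
def openBottoms (w p : ℕ → ℕ) (k : ℕ) : Finset ℕ :=
  {y ∈ range k | k ≤ w (p y - 1)}

/-- The number of descents to the left of `k` that span `k`. -/
def lesAt (w p : ℕ → ℕ) (k : ℕ) : ℕ :=
  #{y ∈ openBottoms w p k | p y < p k}

namespace IsWord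

variable {n : ℕ} {w p : ℕ → ℕ}

theorem p_inj (h : IsWord n w p) {x y : ℕ} (hx : x ≤ n) (hy : y ≤ n) (hxy : p x = p y) :
    x = y := by
  rw [← h.w_p x hx, hxy, h.w_p y hy]

theorem exists_next (h : IsWord n w p) {k : ℕ} (hk : 1 ≤ k) (hkn : k ≤ n) :
    ∃ y ∈ openBottoms w p k, (∀ x < k, p x < p k ↔ p x < p y) ∧
      (w (p k + 1) < k ↔ p y = p k + 1) := by
  have hpk : p k ≤ n := by
    have h1 := h.p_le k hkn
    have h2 := h.w_p k hkn
    have h3 := h.w_last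
    by_contra hc
    rw [show p k = n + 1 by omega] at h2
    omega
  have hex : ∃ q, p k < q ∧ q ≤ n + 1 ∧ w q < k :=
    ⟨n + 1, by omega, le_rfl, by rw [h.w_last]; omega⟩
  obtain ⟨hq1, hq2, hq3⟩ := Nat.find_spec hex
  have hmin : ∀ m, m < Nat.find hex → ¬ (p k < m ∧ m ≤ n + 1 ∧ w m < k) :=
    fun m => Nat.find_min hex
  generalize Nat.find hex = q at hq1 hq2 hq3 hmin
  have hpq : p (w q) = q := h.p_w q (by omega) hq2
  refine ⟨w q, ?_, ?_, ?_⟩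
  · simp only [openBottoms, mem_filter, mem_range]
    refine ⟨hq3, ?_⟩
    rw [hpq]
    by_cases he : q - 1 = p k
    · rw [he, h.w_p k hkn]
    · have := hmin (q - 1) (by omega)
      omega
  · intro x hx
    rw [hpq]
    constructor
    · omega
    · intro hxq
      have h1 : p x ≠ p k := fun e => by
        have := h.p_inj (by omega) hkn e
        omega
      have h2 := hmin (p x) hxq
      rw [h.w_p x (by omega)] at h2
      have := h.p_le x (by omega)
      omega
  · rw [hpq]
    constructor
    · intro h1
      by_contra hc
      exact hmin (p k + 1) (by omega) ⟨by omega, by omega, h1⟩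
    · rintro rfl
      exact hq3

theorem mem_openBottoms_succ (h : IsWord n w p) {k y : ℕ} (hk : 1 ≤ k) (hkn : k ≤ n)
    (hy : y < k) :
    y ∈ openBottoms w p (k + 1) ↔ y ∈ openBottoms w p k ∧ p y ≠ p k + 1 := by
  have h1 : w (p y - 1) = k ↔ p y = p k + 1 := by
    have h2 := h.one_le_p y (by omega)
    have h3 := h.p_le y (by omega)
    constructor
    · intro h4
      have : p y - 1 ≠ 0 := fun e => by rw [e, h.w_zero] at h4; omega
      rw [← h4, h.p_w _ (by omega) (by omega)]
      omega
    · intro h4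
      rw [h4, Nat.add_sub_cancel, h.w_p k hkn]
  rw [Ne, ← h1]
  simp only [openBottoms, mem_filter, mem_range]
  omega

theorem self_mem_openBottoms_succ (k : ℕ) :
    k ∈ openBottoms w p (k + 1) ↔ k < w (p k - 1) := by
  simp only [openBottoms, mem_filter, mem_range]
  omega

theorem eq_of_code_eq {w' p' : ℕ → ℕ} (h : IsWord n w p) (h' : IsWord n w' p')
    (hA : ∀ k, 1 ≤ k → k ≤ n → (w (p k + 1) < k ↔ w' (p' k + 1) < k))
    (hB : ∀ k ≤ n, (k < w (p k - 1) ↔ k < w' (p' k - 1)))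
    (hC : ∀ k, 1 ≤ k → k ≤ n → lesAt w p k = lesAt w' p' k) :
    ∀ v ≤ n, p v = p' v := by
  have key : ∀ m ≤ n, (∀ x < m + 1, ∀ y < m + 1, (p x < p y ↔ p' x < p' y)) ∧
      openBottoms w p (m + 1) = openBottoms w' p' (m + 1) := by
    intro m
    induction m with
    | zero =>
      intro _
      refine ⟨?_, ?_⟩
      · intro x hx y hy
        rw [show x = y by omega]
        simp
      · ext y
        by_cases hy : y = 0
        · subst hy
          rw [self_mem_openBottoms_succ, self_mem_openBottoms_succ, hB 0 (Nat.zero_le _)]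
        · simp only [openBottoms, mem_filter, mem_range]
          omega
    | succ m ih =>
      intro hm
      obtain ⟨ho, hO⟩ := ih (by omega)
      generalize hk : m + 1 = k at ho hO hm ⊢
      have hk1 : 1 ≤ k := by omega
      obtain ⟨y, hyO, hy, hyA⟩ := h.exists_next hk1 hm
      obtain ⟨z, hzO, hz, hzA⟩ := h'.exists_next hk1 hm
      have hlt : ∀ x ∈ openBottoms w p k, x < k := fun x hx =>
        mem_range.mp (mem_filter.mp hx).1
      rw [← hO] at hzO
      have hyk := hlt y hyO
      have hzk := hlt z hzO
      have hcard : #{x ∈ openBottoms w p k | p x < p y} =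
          #{x ∈ openBottoms w p k | p x < p z} := by
        have h1 := hC k hk1 hm
        rw [lesAt, lesAt, ← hO] at h1
        rw [filter_congr (fun x hx => hy x (hlt x hx)),
          filter_congr (fun x hx => hz x (hlt x hx))] at h1
        rw [h1]
        congr 1
        exact filter_congr (fun x hx => (ho x (hlt x hx) z hzk).symm)
      have hmono : ∀ a ∈ openBottoms w p k, ∀ b, p a < p b →
          #{x ∈ openBottoms w p k | p x < p a} < #{x ∈ openBottoms w p k | p x < p b} := by
        intro a ha b hab
        apply card_lt_card
        rw [ssubset_iff_of_subset]
        · exact ⟨a, by simp [ha, hab], by simp⟩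
        · intro x
          simp only [mem_filter]
          exact fun hx => ⟨hx.1, hx.2.trans hab⟩
      have hyz : y = z := by
        apply h.p_inj (by omega) (by omega)
        rcases lt_trichotomy (p y) (p z) with h1 | h1 | h1
        · have := hmono y hyO z h1; omega
        · exact h1
        · have := hmono z hzO y h1; omega
      subst hyz
      have hbelow : ∀ x < k, (p x < p k ↔ p' x < p' k) := fun x hx => by
        rw [hy x hx, hz x hx, ho x hx y hyk]
      have hne : ∀ x < k, p x ≠ p k := fun x hx e => by
        have := h.p_inj (by omega) hm e
        omega
      have hne' : ∀ x < k, p' x ≠ p' k := fun x hx e => by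
        have := h'.p_inj (by omega) hm e
        omega
      refine ⟨?_, ?_⟩
      · intro a ha b hb
        rcases Nat.lt_succ_iff_lt_or_eq.mp ha with ha | ha <;>
          rcases Nat.lt_succ_iff_lt_or_eq.mp hb with hb | hb
        · exact ho a ha b hb
        · rw [hb]; exact hbelow a ha
        · have := hbelow b hb
          have := hne b hb
          have := hne' b hb
          rw [ha]
          omega
        · rw [ha, hb]; simp
      · ext x
        rcases lt_trichotomy x k with hx | hx | hx
        · rw [h.mem_openBottoms_succ hk1 hm hx, h'.mem_openBottoms_succ hk1 hm hx, hO]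
          apply and_congr_right
          intro _
          rw [not_iff_not]
          have hAk := hA k hk1 hm
          constructor
          · intro hpx
            have h1 : w (p k + 1) < k := by rwa [← hpx, h.w_p x (by omega)]
            have h2 : x = y := h.p_inj (by omega) (by omega) (by rw [hpx, hyA.mp h1])
            rw [h2, hzA.mp (hAk.mp h1)]
          · intro hpx
            have h1 : w' (p' k + 1) < k := by rwa [← hpx, h'.w_p x (by omega)]
            have h2 : x = y := h'.p_inj (by omega) (by omega) (by rw [hpx, hzA.mp h1])
            rw [h2, hyA.mp (hAk.mpr h1)]
        · subst hx
          rw [self_mem_openBottoms_succ, self_mem_openBottoms_succ, hB x hm]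
        · simp only [openBottoms, mem_filter, mem_range]
          omega
  have hrank : ∀ {w p : ℕ → ℕ}, IsWord n w p → ∀ v ≤ n,
      #{x ∈ range (n + 1) | p x < p v} = p v - 1 := by
    intro w p h v hv
    rw [← Nat.card_Ico 1 (p v)]
    have := h.p_le v hv
    apply card_bij (fun x _ => p x)
    · intro x hx
      simp only [mem_filter, mem_range, mem_Ico] at hx ⊢
      exact ⟨h.one_le_p x (by omega), hx.2⟩
    · intro x hx y hy hxy
      simp only [mem_filter, mem_range] at hx hy
      exact h.p_inj (by omega) (by omega) hxy
    · intro i hi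
      simp only [mem_Ico] at hi
      have hpi := h.p_w i hi.1 (by omega)
      refine ⟨w i, ?_, hpi⟩
      simp only [mem_filter, mem_range, hpi]
      exact ⟨Nat.lt_succ_of_le (h.w_le i), hi.2⟩
  intro v hv
  have h1 := hrank h v hv
  have h2 := hrank h' v hv
  rw [filter_congr (fun x hx => (key n le_rfl).1 x (mem_range.mp hx) v (by omega)), h2] at h1
  have := h.one_le_p v hv
  have := h'.one_le_p v hv
  omega

theorem card_openBottoms_add (h : IsWord n w p) (k : ℕ) :
    #(openBottoms w p k) + #{a ∈ Icc 1 n | w (p a + 1) < a ∧ a < k} =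
      #{y ∈ range n | y < w (p y - 1) ∧ y < k} := by
  rw [← card_filter_add_card_filter_not (s := {y ∈ range n | y < w (p y - 1) ∧ y < k})
    (fun y => k ≤ w (p y - 1)), filter_filter, filter_filter]
  congr 1
  · congr 1
    ext y
    have := h.w_le (p y - 1)
    simp only [openBottoms, mem_filter, mem_range]
    omega
  · apply card_bij (fun a _ => w (p a + 1))
    · intro a ha
      simp only [mem_filter, mem_range, mem_Icc] at ha ⊢
      have h1 := h.w_p a (by omega)
      have h2 : p a ≠ n + 1 := fun e => by rw [e, h.w_last] at h1; omega
      have h3 := h.p_le a (by omega)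
      rw [h.p_w (p a + 1) (by omega) (by omega), Nat.add_sub_cancel, h1]
      omega
    · intro a ha b hb hab
      simp only [mem_filter, mem_Icc] at ha hb
      have ha1 := h.w_p a (by omega)
      have ha2 : p a ≠ n + 1 := fun e => by rw [e, h.w_last] at ha1; omega
      have ha3 := h.p_le a (by omega)
      have hb1 := h.w_p b (by omega)
      have hb2 : p b ≠ n + 1 := fun e => by rw [e, h.w_last] at hb1; omega
      have hb3 := h.p_le b (by omega)
      have := congrArg p hab
      rw [h.p_w _ (by omega) (by omega), h.p_w _ (by omega) (by omega)] at this
      exact h.p_inj (by omega) (by omega) (by omega)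
    · intro y hy
      simp only [mem_filter, mem_range] at hy
      have h1 := h.one_le_p y (by omega)
      have h2 := h.p_le y (by omega)
      have h3 : p y - 1 ≠ 0 := fun e => by rw [e, h.w_zero] at hy; omega
      have h4 : p (w (p y - 1)) + 1 = p y := by
        rw [h.p_w _ (by omega) (by omega)]; omega
      have h5 := h.w_le (p y - 1)
      have h6 := h.w_p y (by omega)
      refine ⟨w (p y - 1), ?_, by rw [h4, h6]⟩
      simp only [mem_filter, mem_Icc]
      rw [h4, h6]
      omega

theorem card_down_eq_card_up (w : ℕ → ℕ) (k P m : ℕ) (hP : k ≤ w P) (hm : P ≤ m) :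
    #{j ∈ Ioc P m | w j < k ∧ k ≤ w (j - 1)} =
      (if w m < k then 1 else 0) + #{j ∈ Ico (P + 1) m | w j < k ∧ k ≤ w (j + 1)} := by
  induction m, hm using Nat.le_induction with
  | base => simp [hP]
  | succ m hm ih =>
    rw [← insert_Ioc_right_eq_Ioc_add_one hm, filter_insert]
    rcases hm.eq_or_lt with rfl | hlt
    · simp [hP]
      split_ifs <;> simp
    · rw [← insert_Ico_right_eq_Ico_add_one (by omega), filter_insert]
      have n1 : m + 1 ∉ ({j ∈ Ioc P m | w j < k ∧ k ≤ w (j - 1)} : Finset ℕ) := by simp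
      have n2 : m ∉ ({j ∈ Ico (P + 1) m | w j < k ∧ k ≤ w (j + 1)} : Finset ℕ) := by simp
      simp only [Nat.add_sub_cancel]
      by_cases a : w m < k <;> by_cases b : w (m + 1) < k
      · simp only [a, b, not_le.mpr a, not_le.mpr b, and_false, if_true, if_false] at ih ⊢
        exact ih
      · simp only [a, b, not_lt.mp b, not_le.mpr a, and_false, and_true, if_true, if_false,
          card_insert_of_notMem n2] at ih ⊢
        omega
      · simp only [a, b, not_lt.mp a, and_self, false_and, if_true, if_false,
          card_insert_of_notMem n1] at ih ⊢
        omega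
      · simp only [a, b, false_and, if_false] at ih ⊢
        omega

/-- The descents to the left of `k` and the ascents to the right of `k` that span `k` are together
one less than the open bottoms at `k`. -/
theorem lesAt_add_res_add_one (h : IsWord n w p) {k : ℕ} (hk : 1 ≤ k) (hkn : k ≤ n) :
    lesAt w p k + #{j ∈ Icc 1 n | p k < j ∧ j ≤ n - 1 ∧ w j < k ∧ k < w (j + 1)} + 1 =
      #(openBottoms w p k) := by
  have hwk := h.w_p k hkn
  have hpk := h.p_le k hkn
  have hpk1 := h.one_le_p k hkn
  have hlast := h.w_last
  rw [← card_filter_add_card_filter_not (s := openBottoms w p k) (fun y => p y < p k),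
    ← lesAt, add_assoc]
  congr 1
  have h1 := card_down_eq_card_up w k (p k) (n + 1) hwk.ge hpk
  rw [if_pos (by omega)] at h1
  have e1 : #{y ∈ openBottoms w p k | ¬ p y < p k} =
      #{j ∈ Ioc (p k) (n + 1) | w j < k ∧ k ≤ w (j - 1)} := by
    apply card_bij (fun y _ => p y)
    · intro y hy
      simp only [openBottoms, mem_filter, mem_range, mem_Ioc] at hy ⊢
      have h2 := h.w_p y (by omega)
      have h3 := h.p_le y (by omega)
      have h4 : p y ≠ p k := fun e => by
        have := h.p_inj (by omega) hkn e
        omega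
      omega
    · intro x hx y hy hxy
      simp only [openBottoms, mem_filter, mem_range] at hx hy
      exact h.p_inj (by omega) (by omega) hxy
    · intro j hj
      simp only [mem_filter, mem_Ioc] at hj
      have h2 := h.p_w j (by omega) (by omega)
      refine ⟨w j, ?_, h2⟩
      simp only [openBottoms, mem_filter, mem_range, h2]
      omega
  rw [e1, h1, add_comm]
  congr 2
  ext j
  simp only [mem_filter, mem_Icc, mem_Ico]
  constructor
  · omega
  · intro hj
    have h2 : w (j + 1) ≠ k := fun e => by
      have := h.p_w (j + 1) (by omega) (by omega)
      rw [e] at this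
      omega
    have h3 : j ≠ n := fun e => by
      rw [e, hlast] at hj
      omega
    omega

end IsWord

/-- The inverse of `pext n σ`, sending `0` to the final boundary position `n + 1`. -/
def posOf (n : ℕ) (σ : Equiv.Perm (Fin n)) (v : ℕ) : ℕ :=
  if v = 0 then n + 1 else pext n σ⁻¹ v

theorem pext_of_mem {n : ℕ} (σ : Equiv.Perm (Fin n)) {i : ℕ} (h : 1 ≤ i ∧ i ≤ n) :
    pext n σ i = (σ ⟨i - 1, by omega⟩ : ℕ) + 1 :=
  dif_pos h

theorem pext_of_not_mem {n : ℕ} (σ : Equiv.Perm (Fin n)) {i : ℕ} (h : ¬ (1 ≤ i ∧ i ≤ n)) :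
    pext n σ i = 0 :=
  dif_neg h

theorem pext_mem {n : ℕ} (σ : Equiv.Perm (Fin n)) {i : ℕ} (h : 1 ≤ i ∧ i ≤ n) :
    1 ≤ pext n σ i ∧ pext n σ i ≤ n := by
  rw [pext_of_mem σ h]
  omega

theorem pext_pext_inv {n : ℕ} (σ : Equiv.Perm (Fin n)) {i : ℕ} (h : 1 ≤ i ∧ i ≤ n) :
    pext n σ (pext n σ⁻¹ i) = i := by
  rw [pext_of_mem σ (pext_mem σ⁻¹ h)]
  simp only [pext_of_mem σ⁻¹ h, Nat.add_sub_cancel, Fin.eta, ← Equiv.Perm.mul_apply,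
    mul_inv_cancel, Equiv.Perm.one_apply]
  omega

theorem isWord_pext {n : ℕ} (σ : Equiv.Perm (Fin n)) : IsWord n (pext n σ) (posOf n σ) where
  w_zero := pext_of_not_mem σ (by omega)
  w_last := pext_of_not_mem σ (by omega)
  w_le i := by
    by_cases h : 1 ≤ i ∧ i ≤ n
    · exact (pext_mem σ h).2
    · rw [pext_of_not_mem σ h]; omega
  one_le_p v hv := by
    unfold posOf
    split_ifs with h
    · omega
    · exact (pext_mem σ⁻¹ ⟨by omega, hv⟩).1
  p_le v hv := by
    unfold posOf
    split_ifs with h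
    · omega
    · have := (pext_mem σ⁻¹ (i := v) ⟨by omega, hv⟩).2
      omega
  w_p v hv := by
    unfold posOf
    split_ifs with h
    · rw [pext_of_not_mem σ (by omega), h]
    · exact pext_pext_inv σ ⟨by omega, hv⟩
  p_w i h1 h2 := by
    unfold posOf
    by_cases h : i ≤ n
    · have := pext_mem σ ⟨h1, h⟩
      rw [if_neg (by omega)]
      have h3 := pext_pext_inv σ⁻¹ ⟨h1, h⟩
      rwa [inv_inv] at h3
    · rw [pext_of_not_mem σ (by omega), if_pos rfl]
      omega

namespace IsWord

variable {n : ℕ} {w p : ℕ → ℕ}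

theorem mem_Icc_p (h : IsWord n w p) {k : ℕ} (hk : k ∈ Icc 1 n) : p k ∈ Icc 1 n := by
  rw [mem_Icc] at hk ⊢
  have h1 := h.one_le_p k hk.2
  have h2 := h.p_le k hk.2
  have h3 : p k ≠ n + 1 := fun e => by
    have := h.w_p k hk.2
    rw [e, h.w_last] at this
    omega
  omega

theorem mem_Icc_w (h : IsWord n w p) {i : ℕ} (hi : i ∈ Icc 1 n) : w i ∈ Icc 1 n := by
  rw [mem_Icc] at hi ⊢
  have h1 := h.w_le i
  have h3 : w i ≠ 0 := fun e => by
    have h4 := h.p_w i (by omega) (by omega)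
    have h5 := h.p_w (n + 1) (by omega) (by omega)
    rw [h.w_last] at h5
    rw [e] at h4
    omega
  omega

theorem sum_comp_p (h : IsWord n w p) (g : ℕ → ℕ) :
    ∑ j ∈ Icc 1 n, g j = ∑ k ∈ Icc 1 n, g (p k) := by
  symm
  apply sum_nbij' p w
  · exact fun k hk => h.mem_Icc_p hk
  · exact fun i hi => h.mem_Icc_w hi
  · exact fun k hk => h.w_p k (mem_Icc.mp hk).2
  · intro i hi
    rw [mem_Icc] at hi
    exact h.p_w i hi.1 (by omega)
  · exact fun _ _ => rfl

end IsWord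

theorem lesStat_eq_sum {n : ℕ} (σ : Equiv.Perm (Fin n)) :
    lesStat n σ = ∑ k ∈ Icc 1 n, lesAt (pext n σ) (posOf n σ) k := by
  have h := isWord_pext σ
  rw [lesStat, pairs, card_filter, sum_product_right, h.sum_comp_p]
  apply sum_congr rfl
  intro k hk
  have hpk := mem_Icc.mp (h.mem_Icc_p hk)
  have hk' := mem_Icc.mp hk
  have hwk := h.w_p k hk'.2
  have h0 := h.w_zero
  rw [← card_filter, lesAt]
  apply card_bij (fun i _ => pext n σ i)
  · intro i hi
    simp only [mem_filter, mem_Icc, hwk] at hi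
    have := h.p_w i (by omega) (by omega)
    simp only [openBottoms, mem_filter, mem_range, this]
    omega
  · intro i hi j hj hij
    simp only [mem_filter, mem_Icc] at hi hj
    rw [← h.p_w i (by omega) (by omega), hij, h.p_w j (by omega) (by omega)]
  · intro y hy
    simp only [openBottoms, mem_filter, mem_range] at hy
    have h1 := h.w_p y (by omega)
    have h2 := h.one_le_p y (by omega)
    have h3 : posOf n σ y - 1 ≠ 0 := fun e => by rw [e] at hy; omega
    have h4 : pext n σ (posOf n σ y - 1) ≠ k := fun e => by
      have := h.p_w (posOf n σ y - 1) (by omega) (by omega)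
      rw [e] at this
      omega
    refine ⟨posOf n σ y, ?_, h1⟩
    simp only [mem_filter, mem_Icc, hwk, h1]
    omega

theorem resStat_eq_sum {n : ℕ} (σ : Equiv.Perm (Fin n)) :
    resStat n σ = ∑ k ∈ Icc 1 n, #{j ∈ Icc 1 n | posOf n σ k < j ∧ j ≤ n - 1 ∧
      pext n σ j < k ∧ k < pext n σ (j + 1)} := by
  have h := isWord_pext σ
  rw [resStat, pairs, card_filter, sum_product, h.sum_comp_p]
  apply sum_congr rfl
  intro k hk
  rw [← card_filter]
  simp only [h.w_p k (mem_Icc.mp hk).2]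

theorem desStat_add_one {n : ℕ} (hn : 1 ≤ n) (σ : Equiv.Perm (Fin n)) :
    desStat n σ + 1 = #{k ∈ Icc 1 n | pext n σ (posOf n σ k + 1) < k} := by
  have h := isWord_pext σ
  have h1 : #{k ∈ Icc 1 n | pext n σ (posOf n σ k + 1) < k} =
      #{i ∈ Icc 1 n | pext n σ (i + 1) < pext n σ i} := by
    rw [card_filter, card_filter,
      h.sum_comp_p (fun i => if pext n σ (i + 1) < pext n σ i then 1 else 0)]
    apply sum_congr rfl
    intro k hk
    rw [h.w_p k (mem_Icc.mp hk).2]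
  have h2 : Icc 1 n = insert n (Icc 1 (n - 1)) := by
    ext i
    simp only [mem_Icc, mem_insert]
    omega
  have h3 := mem_Icc.mp (h.mem_Icc_w (i := n) (by simp [hn]))
  rw [h1, h2, filter_insert, if_pos (by rw [h.w_last]; omega), card_insert_of_notMem (by
    simp only [mem_filter, mem_Icc]; omega), desStat]

theorem crosStarStat_eq_sum (n : ℕ) (τ : Equiv.Perm (Fin n)) :
    crosStarStat n τ = ∑ k ∈ Icc 1 n, crosAt n (starf n τ) k := by
  rw [crosStarStat, pairs, card_filter, sum_product_right]
  simp only [crosAt, card_filter]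

theorem nestStarStat_eq_sum (n : ℕ) (τ : Equiv.Perm (Fin n)) :
    nestStarStat n τ = ∑ k ∈ Icc 1 n, nestAt n (starf n τ) k := by
  rw [nestStarStat, pairs, card_filter, sum_product_right]
  simp only [nestAt, card_filter]

theorem starf_eq {n : ℕ} (τ : Equiv.Perm (Fin n)) {k : ℕ} (h : 1 ≤ k ∧ k ≤ n) :
    starf n τ k = (τ ⟨k - 1, by omega⟩ : ℕ) := by
  rw [starf, if_pos h, pext_of_mem τ h, Nat.add_sub_cancel]

theorem starf_lt {n : ℕ} (τ : Equiv.Perm (Fin n)) {k : ℕ} (hk : k ∈ Icc 1 n) :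
    starf n τ k < n := by
  rw [starf_eq τ (mem_Icc.mp hk)]
  exact Fin.is_lt _

theorem starf_injOn {n : ℕ} (τ : Equiv.Perm (Fin n)) : Set.InjOn (starf n τ) (Icc 1 n) := by
  intro x hx y hy hxy
  have hx' := mem_Icc.mp (mem_coe.mp hx)
  have hy' := mem_Icc.mp (mem_coe.mp hy)
  rw [starf_eq τ hx', starf_eq τ hy', ← Fin.ext_iff, τ.injective.eq_iff, Fin.ext_iff] at hxy
  simp only at hxy
  omega

theorem exists_starf_eqOn {n : ℕ} (F : ℕ → ℕ) (hF : ∀ k ∈ Icc 1 n, F k < n)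
    (hinj : Set.InjOn F (Icc 1 n)) :
    ∃ τ : Equiv.Perm (Fin n), ∀ k ∈ Icc 1 n, starf n τ k = F k := by
  have hm : ∀ i : Fin n, (i : ℕ) + 1 ∈ Icc 1 n := fun i => by rw [mem_Icc]; omega
  let f : Fin n → Fin n := fun i => ⟨F (i + 1), hF _ (hm i)⟩
  have hf : Function.Injective f := by
    intro i j hij
    have := hinj (hm i) (hm j) (Fin.ext_iff.mp hij)
    exact Fin.ext (by omega)
  refine ⟨Equiv.ofBijective f (Finite.injective_iff_bijective.mp hf), ?_⟩
  intro k hk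
  have hk' := mem_Icc.mp hk
  rw [starf_eq _ hk']
  change F (k - 1 + 1) = F k
  rw [Nat.sub_add_cancel hk'.1]

/-- `τ` has the descent tops of `σ` as drop positions, the descent bottoms of `σ` (including
the final boundary `0`) as drop values, and the crossing numbers of `τ` are those given by
`lesAt`. -/
structure SameCode (n : ℕ) (σ τ : Equiv.Perm (Fin n)) : Prop where
  top : ∀ k ∈ Icc 1 n, pext n σ (posOf n σ k + 1) < k ↔ starf n τ k < k
  bottom : ∀ v < n, v < pext n σ (posOf n σ v - 1) ↔ ∃ k ∈ Icc 1 n, starf n τ k = v ∧ v < k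
  cros : ∀ k ∈ Icc 1 n, lesAt (pext n σ) (posOf n σ) k = crosAt n (starf n τ) k

theorem exists_sameCode {n : ℕ} (σ : Equiv.Perm (Fin n)) : ∃ τ, SameCode n σ τ := by
  have h := isWord_pext σ
  set w := pext n σ with hw
  set p := posOf n σ with hp
  have hcard : #{a ∈ Icc 1 n | w (p a + 1) < a} = #{y ∈ range n | y < w (p y - 1)} := by
    have h1 := h.card_openBottoms_add (n + 1)
    have h2 : openBottoms w p (n + 1) = ∅ := by
      apply filter_false_of_mem
      intro y _
      have := h.w_le (p y - 1)
      omega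
    rw [h2, card_empty, zero_add] at h1
    convert h1 using 2
    · apply filter_congr
      intro a ha
      rw [mem_Icc] at ha
      omega
    · apply filter_congr
      intro a ha
      rw [mem_range] at ha
      omega
  obtain ⟨F, hFn, hFi, hFA, hFB, hFc⟩ := exists_crosAt_eq n _ _ (lesAt w p)
    (filter_subset _ _) (filter_subset _ _) hcard (by
      intro k hk
      have hk' := mem_Icc.mp hk
      have h1 := h.card_openBottoms_add k
      have h2 := h.lesAt_add_res_add_one hk'.1 hk'.2
      rw [filter_filter, filter_filter]
      omega)
  obtain ⟨τ, hτ⟩ := exists_starf_eqOn F hFn hFi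
  refine ⟨τ, ?_, ?_, ?_⟩
  · intro k hk
    rw [hτ k hk, ← hFA k hk, mem_filter]
    exact (and_iff_right hk).symm
  · intro v hv
    constructor
    · intro hvB
      have himg : ({a ∈ Icc 1 n | w (p a + 1) < a} : Finset ℕ).image F =
          {y ∈ range n | y < w (p y - 1)} := by
        apply eq_of_subset_of_card_le
        · intro x hx
          obtain ⟨i, hi, rfl⟩ := mem_image.mp hx
          exact hFB i hi
        · rw [card_image_of_injOn (hFi.mono (coe_subset.mpr (filter_subset _ _))), hcard]
      have hv' : v ∈ ({y ∈ range n | y < w (p y - 1)} : Finset ℕ) :=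
        mem_filter.mpr ⟨mem_range.mpr hv, hvB⟩
      rw [← himg] at hv'
      obtain ⟨k, hk, rfl⟩ := mem_image.mp hv'
      have hk1 := (mem_filter.mp hk).1
      exact ⟨k, hk1, hτ k hk1, (hFA k hk1).mp hk⟩
    · rintro ⟨k, hk, rfl, hlt⟩
      rw [hτ k hk] at hlt ⊢
      exact (mem_filter.mp (hFB k ((hFA k hk).mpr hlt))).2
  · intro k hk
    rw [← hFc k hk, crosAt, crosAt]
    congr 1
    apply filter_congr
    intro i hi
    rw [hτ i hi, hτ k hk]

namespace SameCode

variable {n : ℕ} {σ τ : Equiv.Perm (Fin n)}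

theorem les_eq (h : SameCode n σ τ) : lesStat n σ = crosStarStat n τ := by
  rw [lesStat_eq_sum, crosStarStat_eq_sum]
  exact sum_congr rfl h.cros

theorem des_eq (h : SameCode n σ τ) (hn : 1 ≤ n) : desStat n σ = dropStarStat n τ - 1 := by
  have h1 := desStat_add_one hn σ
  rw [filter_congr h.top] at h1
  rw [dropStarStat, ← h1, Nat.add_sub_cancel]

theorem res_eq (h : SameCode n σ τ) : resStat n σ = nestStarStat n τ := by
  rw [resStat_eq_sum, nestStarStat_eq_sum]
  apply sum_congr rfl
  intro k hk
  have hk' := mem_Icc.mp hk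
  have hw := isWord_pext σ
  have h1 := hw.card_openBottoms_add k
  have h2 := hw.lesAt_add_res_add_one hk'.1 hk'.2
  have h3 := crosAt_add_nestAt n (starf n τ) (fun _ => starf_lt τ) (starf_injOn τ) k hk
  have h4 : #{i ∈ Icc 1 n | starf n τ i < i ∧ starf n τ i < k} =
      #{y ∈ range n | y < pext n σ (posOf n σ y - 1) ∧ y < k} := by
    apply card_bij (fun i _ => starf n τ i)
    · intro i hi
      simp only [mem_filter] at hi
      have hin := starf_lt τ hi.1
      exact mem_filter.mpr ⟨mem_range.mpr hin,
        (h.bottom _ hin).mpr ⟨i, hi.1, rfl, hi.2.1⟩, hi.2.2⟩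
    · intro i hi j hj hij
      exact starf_injOn τ (mem_filter.mp hi).1 (mem_filter.mp hj).1 hij
    · intro y hy
      simp only [mem_filter, mem_range] at hy
      obtain ⟨i, hi, rfl, hlt⟩ := (h.bottom y hy.1).mp hy.2.1
      exact ⟨i, mem_filter.mpr ⟨hi, hlt, hy.2.2⟩, rfl⟩
  have h5 : #{a ∈ Icc 1 n | pext n σ (posOf n σ a + 1) < a ∧ a < k} =
      #{i ∈ Icc 1 n | starf n τ i < i ∧ i < k} := by
    congr 1
    apply filter_congr
    intro i hi
    rw [h.top i hi]
  rw [h.cros k hk] at h2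
  omega

theorem left_unique {σ' : Equiv.Perm (Fin n)} (h : SameCode n σ τ) (h' : SameCode n σ' τ) :
    σ = σ' := by
  have hw := isWord_pext σ
  have hw' := isWord_pext σ'
  have key : ∀ v ≤ n, posOf n σ v = posOf n σ' v := by
    apply hw.eq_of_code_eq hw'
    · intro k hk hkn
      have hm := mem_Icc.mpr ⟨hk, hkn⟩
      rw [h.top k hm, h'.top k hm]
    · intro k hk
      rcases hk.eq_or_lt with rfl | hlt
      · have h1 := hw.w_le (posOf k σ k - 1)
        have h2 := hw'.w_le (posOf k σ' k - 1)
        omega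
      · rw [h.bottom k hlt, h'.bottom k hlt]
    · intro k hk hkn
      have hm := mem_Icc.mpr ⟨hk, hkn⟩
      rw [h.cros k hm, h'.cros k hm]
  rw [← inv_inj]
  ext i
  have := key (i + 1) (by omega)
  rw [posOf, posOf, if_neg (by omega), if_neg (by omega), pext_of_mem _ (by omega),
    pext_of_mem _ (by omega)] at this
  simpa using this

end SameCode

theorem statement15 (n : ℕ) (hn : 1 ≤ n) :
    ∃ Ψ : Equiv.Perm (Fin n) → Equiv.Perm (Fin n), Function.Bijective Ψ ∧
      ∀ σ : Equiv.Perm (Fin n),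
        resStat n σ = nestStarStat n (Ψ σ) ∧
        lesStat n σ = crosStarStat n (Ψ σ) ∧
        desStat n σ = dropStarStat n (Ψ σ) - 1 := by
  choose Ψ hΨ using fun σ : Equiv.Perm (Fin n) => exists_sameCode σ
  refine ⟨Ψ, Finite.injective_iff_bijective.mp ?_, fun σ =>
    ⟨(hΨ σ).res_eq, (hΨ σ).les_eq, (hΨ σ).des_eq hn⟩⟩
  intro σ σ' he
  exact (hΨ σ).left_unique (he ▸ hΨ σ')

end SZpaper
end
end

section
/- For every integer n ≥ 1, the following identity holds in ℤ[β,t]: Σ_{σ∈S_n} β^{cyc* σ − fix* σ} t^{exc σ} = Σ_{k=0}^{⌊(n−1)/2⌋} d_{n,k}(β) · t^k · (1+t)^{n−1−2k}, where d_{n,k}(β) = Σ_{σ∈S_n(k)} β^{cyc* σ − fix* σ} and S_n(k) is the set of permutations σ of [n] with cvalley* σ = k and cdd* σ = 0. -/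
open scoped Classical
open Finset

noncomputable section

namespace SZpaper

open MvPolynomial in
/-- `d_{n,k}(β)` (with `β = X 0`), as an element of `ℤ[β,t]`: the sum of
`β^{cyc* σ − fix* σ}` over permutations of `[n]` with `cvalley* σ = k` and
`cdd* σ = 0`. -/
def dPoly (n k : ℕ) : MvPolynomial (Fin 2) ℤ :=
  ∑ σ ∈ Finset.univ.filter
      (fun σ : Equiv.Perm (Fin n) =>
        cvalleyStarStat n σ = k ∧ cddStarStat n σ = 0),
    X 0 ^ (cycStarStat n σ - fixStarStat n σ)

/-! ### Basic facts about `σ*` and its inverse -/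

lemma starf_succ {n : ℕ} (σ : Equiv.Perm (Fin n)) (i : Fin n) :
    starf n σ ((i : ℕ) + 1) = σ i := by
  simp [starf, pext]

lemma starf_of_lt {n : ℕ} (σ : Equiv.Perm (Fin n)) {i : ℕ} (hi : n < i) :
    starf n σ i = 0 := by
  simp [starf, hi]

lemma starf_zero {n : ℕ} (σ : Equiv.Perm (Fin n)) : starf n σ 0 = 0 := by
  simp [starf]

lemma invstarf_val {n : ℕ} (σ : Equiv.Perm (Fin n)) (i : Fin n) :
    invstarf n σ i = (σ⁻¹ i : Fin n) + 1 := by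
  simp [invstarf, pext]

lemma invstarf_self {n : ℕ} (σ : Equiv.Perm (Fin n)) : invstarf n σ n = 0 := by
  simp [invstarf, pext]

lemma starf_eq_iff {n : ℕ} (σ : Equiv.Perm (Fin n)) {y : ℕ} (h1 : 1 ≤ y) (h2 : y < n) (z : ℕ) :
    starf n σ z = y ↔ z = invstarf n σ y := by
  have hv := invstarf_val σ ⟨y, h2⟩
  simp only at hv
  rw [hv]
  constructor
  · intro h
    rcases z with _ | z
    · rw [starf_zero] at h; omega
    · by_cases hz : z < n
      · have := starf_succ σ ⟨z, hz⟩
        simp only at this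
        rw [this] at h
        have h3 : σ ⟨z, hz⟩ = ⟨y, h2⟩ := Fin.ext h
        rw [← h3]; simp
      · rw [starf_of_lt σ (by omega)] at h; omega
  · rintro rfl
    rw [starf_succ]; simp

lemma starf_lt_s16 {n : ℕ} (σ : Equiv.Perm (Fin n)) (hn : 1 ≤ n) (y : ℕ) : starf n σ y < n := by
  rcases y with _ | y
  · rw [starf_zero]; omega
  · by_cases hy : y < n
    · rw [starf_succ σ ⟨y, hy⟩]; exact Fin.isLt _
    · rw [starf_of_lt σ (by omega)]; omega

lemma starf_invstarf {n : ℕ} (σ : Equiv.Perm (Fin n)) {y : ℕ} (hy : y < n) :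
    starf n σ (invstarf n σ y) = y := by
  rw [invstarf_val σ ⟨y, hy⟩, starf_succ]; simp

lemma invstarf_starf {n : ℕ} (σ : Equiv.Perm (Fin n)) {y : ℕ} (hy : 1 ≤ y ∧ y ≤ n) :
    invstarf n σ (starf n σ y) = y := by
  obtain ⟨i, rfl⟩ : ∃ i : Fin n, y = i + 1 := ⟨⟨y - 1, by omega⟩, by simp; omega⟩
  rw [starf_succ, invstarf_val]; simp

/-! ### Deleting a point `x` from the digraph of `σ*` -/

/-- The permutation whose star map makes `x` a fixed point and short-circuits the
path `a → x → b` to `a → b` (for `1 ≤ x < n`). -/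
def remPt {n : ℕ} (e v : Fin n) (σ : Equiv.Perm (Fin n)) : Equiv.Perm (Fin n) :=
  Equiv.swap v (σ e) * σ

lemma starf_remPt_self {n : ℕ} {e v : Fin n} (h : (v : ℕ) = e + 1) (σ : Equiv.Perm (Fin n)) :
    starf n (remPt e v σ) v = v := by
  rw [h, starf_succ]; simp [remPt, h]

lemma starf_remPt {n : ℕ} {e v : Fin n} (h : (v : ℕ) = e + 1) (σ : Equiv.Perm (Fin n))
    {y : ℕ} (hy : y ≠ v) :
    starf n (remPt e v σ) y = if starf n σ y = v then starf n σ v else starf n σ y := by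
  rcases y with _ | y
  · simp only [starf_zero]; split_ifs <;> omega
  · by_cases hyn : y < n
    · have h1 := starf_succ σ ⟨y, hyn⟩
      have h2 := starf_succ (remPt e v σ) ⟨y, hyn⟩
      have h3 := starf_succ σ e
      simp only at h1 h2
      rw [← h] at h3
      rw [h1, h2, h3]
      have hne : σ ⟨y, hyn⟩ ≠ σ e := by
        intro h'
        have := congrArg Fin.val (σ.injective h')
        simp only at this; omega
      by_cases hv : σ ⟨y, hyn⟩ = v
      · simp [remPt, hv]
      · have hv' : (σ ⟨y, hyn⟩ : ℕ) ≠ v := fun h' => hv (Fin.ext h')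
        simp [remPt, hv', Equiv.swap_apply_of_ne_of_ne hv hne]
    · simp only [starf_of_lt _ (show n < y + 1 by omega)]; split_ifs <;> omega

lemma invstarf_remPt {n : ℕ} {e v : Fin n} (h : (v : ℕ) = e + 1) (σ : Equiv.Perm (Fin n))
    {y : ℕ} (hy : y ≠ v) (hyn : y < n) :
    invstarf n (remPt e v σ) y =
      if y = starf n σ v then invstarf n σ v else invstarf n σ y := by
  have h1 := invstarf_val σ ⟨y, hyn⟩
  have h2 := invstarf_val (remPt e v σ) ⟨y, hyn⟩
  have h3 := starf_succ σ e
  simp only at h1 h2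
  rw [← h] at h3
  rw [h1, h2, h3, invstarf_val]
  have hne : (⟨y, hyn⟩ : Fin n) ≠ v := fun h' => hy (by rw [← h'])
  by_cases hv : (⟨y, hyn⟩ : Fin n) = σ e
  · have hv' : y = (σ e : ℕ) := by rw [← hv]
    simp [remPt, ← hv']
    simp [hv]
  · have hv' : y ≠ (σ e : ℕ) := fun h' => hv (Fin.ext h')
    simp [remPt, hv', Equiv.swap_apply_of_ne_of_ne hne hv]

/-! ### Types of points -/

def IsVal (n : ℕ) (σ : Equiv.Perm (Fin n)) (y : ℕ) : Prop :=
  y < invstarf n σ y ∧ y < starf n σ y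

def IsDrop (n : ℕ) (σ : Equiv.Perm (Fin n)) (y : ℕ) : Prop :=
  y < invstarf n σ y ∧ starf n σ y < y

/-- Double excedances and fixed points of `σ*`. -/
def IsRise (n : ℕ) (σ : Equiv.Perm (Fin n)) (y : ℕ) : Prop :=
  invstarf n σ y ≤ y ∧ y ≤ starf n σ y

lemma types_remPt {n : ℕ} {e v : Fin n} (h : (v : ℕ) = e + 1) (σ : Equiv.Perm (Fin n))
    (hx : IsRise n σ v ∨ IsDrop n σ v) {y : ℕ} (h1 : 1 ≤ y) (hyn : y < n) (hy : y ≠ v) :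
    (IsVal n (remPt e v σ) y ↔ IsVal n σ y) ∧ (IsDrop n (remPt e v σ) y ↔ IsDrop n σ y) ∧
      (IsRise n (remPt e v σ) y ↔ IsRise n σ y) := by
  have hf := starf_remPt h σ hy
  have hi := invstarf_remPt h σ hy hyn
  have e1 := starf_eq_iff σ (show 1 ≤ (v : ℕ) by omega) v.isLt y
  have e2 := starf_eq_iff σ h1 hyn v
  unfold IsVal IsDrop IsRise at *
  rw [hf, hi]
  split_ifs with c1 c2 c2
  all_goals omega

lemma card_rise_fiber {n : ℕ} {e v : Fin n} (h : (v : ℕ) = e + 1) (τ : Equiv.Perm (Fin n))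
    (hτ : τ e = v) :
    (univ.filter fun σ : Equiv.Perm (Fin n) => IsRise n σ v ∧ remPt e v σ = τ).card =
      (univ.filter fun σ : Equiv.Perm (Fin n) => IsDrop n σ v ∧ remPt e v σ = τ).card := by
  have key : ∀ σ : Equiv.Perm (Fin n), remPt e v σ = τ → σ = Equiv.swap v (τ (σ⁻¹ v)) * τ := by
    rintro σ rfl
    simp [remPt, ← mul_assoc]
  have key2 : ∀ a : Fin n, remPt e v (Equiv.swap v (τ a) * τ) = τ := by
    intro a
    simp [remPt, hτ, ← mul_assoc]
  have key3 : ∀ a : Fin n, (Equiv.swap v (τ a) * τ)⁻¹ v = a := by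
    intro a; simp
  have key4 : ∀ σ : Equiv.Perm (Fin n), remPt e v σ = τ → σ e = τ (σ⁻¹ v) := by
    rintro σ rfl
    simp [remPt]
  have fe : ∀ σ : Equiv.Perm (Fin n), starf n σ v = σ e := by
    intro σ; rw [h, starf_succ]
  have c1 : (univ.filter fun σ : Equiv.Perm (Fin n) => IsRise n σ v ∧ remPt e v σ = τ).card =
      ((univ.filter fun a : Fin n => a ≤ e) \ (univ.filter fun a : Fin n => τ a < v)).card := by
    refine Finset.card_nbij' (fun σ => σ⁻¹ v) (fun a => Equiv.swap v (τ a) * τ) ?_ ?_ ?_ ?_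
    · intro σ hσ
      simp only [coe_filter, mem_univ, true_and, Set.mem_ofPred_eq, IsRise, invstarf_val, fe] at hσ
      simp only [coe_sdiff, coe_filter, mem_univ, true_and, Set.mem_sdiff, Set.mem_ofPred_eq]
      rw [← key4 σ hσ.2, Fin.le_def, Fin.lt_def]
      omega
    · intro a ha
      simp only [coe_sdiff, coe_filter, mem_univ, true_and, Set.mem_sdiff, Set.mem_ofPred_eq,
        Fin.le_def, Fin.lt_def] at ha
      simp only [coe_filter, mem_univ, true_and, Set.mem_ofPred_eq, IsRise, invstarf_val, fe]
      refine ⟨?_, key2 a⟩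
      rw [key4 _ (key2 a), key3]
      omega
    · intro σ hσ
      simp only [coe_filter, mem_univ, true_and, Set.mem_ofPred_eq] at hσ
      exact (key σ hσ.2).symm
    · intro a _
      exact key3 a
  have c2 : (univ.filter fun σ : Equiv.Perm (Fin n) => IsDrop n σ v ∧ remPt e v σ = τ).card =
      ((univ.filter fun a : Fin n => τ a < v) \ (univ.filter fun a : Fin n => a ≤ e)).card := by
    refine Finset.card_nbij' (fun σ => σ⁻¹ v) (fun a => Equiv.swap v (τ a) * τ) ?_ ?_ ?_ ?_
    · intro σ hσ
      simp only [coe_filter, mem_univ, true_and, Set.mem_ofPred_eq, IsDrop, invstarf_val, fe] at hσ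
      simp only [coe_sdiff, coe_filter, mem_univ, true_and, Set.mem_sdiff, Set.mem_ofPred_eq]
      rw [← key4 σ hσ.2, Fin.le_def, Fin.lt_def]
      omega
    · intro a ha
      simp only [coe_sdiff, coe_filter, mem_univ, true_and, Set.mem_sdiff, Set.mem_ofPred_eq,
        Fin.le_def, Fin.lt_def] at ha
      simp only [coe_filter, mem_univ, true_and, Set.mem_ofPred_eq, IsDrop, invstarf_val, fe]
      refine ⟨?_, key2 a⟩
      rw [key4 _ (key2 a), key3]
      omega
    · intro σ hσ
      simp only [coe_filter, mem_univ, true_and, Set.mem_ofPred_eq] at hσ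
      exact (key σ hσ.2).symm
    · intro a _
      exact key3 a
  rw [c1, c2]
  apply Finset.card_sdiff_comm
  refine (Finset.card_equiv τ fun a => ?_).symm
  simp only [mem_filter, mem_univ, true_and, Fin.le_def, Fin.lt_def]
  omega

lemma sum_rise_eq_sum_drop {R : Type*} [CommRing R] {n : ℕ} {e v : Fin n} (h : (v : ℕ) = e + 1)
    (Φ : Equiv.Perm (Fin n) → R)
    (hΦ : ∀ σ, IsRise n σ v ∨ IsDrop n σ v → Φ (remPt e v σ) = Φ σ) :
    ∑ σ with IsRise n σ v, Φ σ = ∑ σ with IsDrop n σ v, Φ σ := by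
  have hmap : ∀ σ : Equiv.Perm (Fin n),
      remPt e v σ ∈ univ.filter fun τ : Equiv.Perm (Fin n) => τ e = v := by
    intro σ; simp [remPt]
  rw [← Finset.sum_fiberwise_of_maps_to (s := univ.filter fun σ => IsRise n σ v)
      (fun σ _ => hmap σ),
    ← Finset.sum_fiberwise_of_maps_to (s := univ.filter fun σ => IsDrop n σ v)
      (fun σ _ => hmap σ)]
  refine Finset.sum_congr rfl fun τ hτ => ?_
  have e1 : ∀ P : Equiv.Perm (Fin n) → Prop, (∀ σ, P σ → IsRise n σ v ∨ IsDrop n σ v) →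
      ∑ σ ∈ (univ.filter P).filter (fun σ => remPt e v σ = τ), Φ σ =
        (univ.filter fun σ => P σ ∧ remPt e v σ = τ).card • Φ τ := by
    intro P hP
    rw [Finset.filter_filter]
    refine Finset.sum_eq_card_nsmul fun σ hσ => ?_
    simp only [mem_filter, mem_univ, true_and] at hσ
    rw [← hσ.2, hΦ σ (hP σ hσ.1)]
  rw [e1 _ (fun σ hσ => Or.inl hσ), e1 _ (fun σ hσ => Or.inr hσ),
    card_rise_fiber h τ (by simpa using hτ)]

/-! ### Nontrivial cycles -/

lemma forall_le_iterate_iff (f : ℕ → ℕ) (i : ℕ) :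
    (∀ m, i ≤ f^[m] i) ↔ ∃ S : Set ℕ, i ∈ S ∧ (∀ y ∈ S, f y ∈ S) ∧ ∀ y ∈ S, i ≤ y := by
  constructor
  · intro h
    refine ⟨Set.range fun m => f^[m] i, ⟨0, rfl⟩, ?_, ?_⟩
    · rintro _ ⟨m, rfl⟩
      exact ⟨m + 1, Function.iterate_succ_apply' f m i⟩
    · rintro _ ⟨m, rfl⟩
      exact h m
  · rintro ⟨S, hi, hS, hle⟩ m
    apply hle
    induction m with
    | zero => exact hi
    | succ m ih => rw [Function.iterate_succ_apply']; exact hS _ ih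

lemma forall_le_iterate_congr {f g : ℕ → ℕ} {x a i : ℕ} (hi : i ≠ x) (ha : a ≠ x)
    (hfa : ∀ y, f y = x ↔ y = a) (hg : ∀ y, y ≠ x → g y = if f y = x then f x else f y)
    (hx : a < x ∧ x < f x ∨ f x < x ∧ x < a) :
    (∀ m, i ≤ f^[m] i) ↔ ∀ m, i ≤ g^[m] i := by
  rw [forall_le_iterate_iff, forall_le_iterate_iff]
  have hga : g a = f x := by rw [hg a ha, if_pos ((hfa a).2 rfl)]
  constructor
  · rintro ⟨S, h1, h2, h3⟩
    refine ⟨S \ {x}, ⟨h1, hi⟩, ?_, fun y hy => h3 y hy.1⟩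
    rintro y ⟨hy, hyx⟩
    rw [hg y hyx]
    split_ifs with c
    · refine ⟨c ▸ h2 _ (h2 _ hy), ?_⟩
      simp only [Set.mem_singleton_iff]; omega
    · exact ⟨h2 _ hy, c⟩
  · rintro ⟨S, h1, h2, h3⟩
    refine ⟨(S \ {x}) ∪ {y | y = x ∧ a ∈ S}, Or.inl ⟨h1, hi⟩, ?_, ?_⟩
    · rintro y (⟨hy, hyx⟩ | ⟨rfl, hy⟩)
      · by_cases c : f y = x
        · exact Or.inr ⟨c, (hfa y).1 c ▸ hy⟩
        · refine Or.inl ⟨?_, c⟩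
          have := h2 y hy
          rwa [hg y hyx, if_neg c] at this
      · refine Or.inl ⟨hga ▸ h2 a hy, ?_⟩
        simp only [Set.mem_singleton_iff]; omega
    · rintro y (⟨hy, -⟩ | ⟨rfl, hy⟩)
      · exact h3 y hy
      · have := h3 a hy
        have := h3 _ (h2 a hy)
        omega

lemma starf_injOn_s16 {n : ℕ} (σ : Equiv.Perm (Fin n)) {y z : ℕ} (hy : 1 ≤ starf n σ y) (hn : 1 ≤ n)
    (h : starf n σ y = starf n σ z) : y = z := by
  rw [(starf_eq_iff σ hy (starf_lt_s16 σ hn y) y).1 rfl]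
  exact ((starf_eq_iff σ hy (starf_lt_s16 σ hn y) z).1 h.symm).symm

lemma exists_iterate_eq {n : ℕ} (σ : Equiv.Perm (Fin n)) {i : ℕ} (hi : i ∈ Finset.Icc 1 n)
    (h : ∀ m, i ≤ (starf n σ)^[m] i) : ∃ m ∈ Finset.Icc 1 n, (starf n σ)^[m] i = i := by
  rw [Finset.mem_Icc] at hi
  have hn : 1 ≤ n := hi.1.trans hi.2
  have hmaps : ∀ m ∈ Finset.range (n + 1), (starf n σ)^[m] i ∈ Finset.Icc 1 n := by
    intro m _
    rw [Finset.mem_Icc]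
    refine ⟨hi.1.trans (h m), ?_⟩
    rcases m with _ | m
    · exact hi.2
    · rw [Function.iterate_succ_apply']; exact (starf_lt_s16 σ hn _).le
  have hinj : ∀ j d, (starf n σ)^[j + d] i = (starf n σ)^[j] i → (starf n σ)^[d] i = i := by
    intro j
    induction j with
    | zero => intro d hd; simpa using hd
    | succ j ih =>
      intro d hd
      apply ih
      rw [show j + 1 + d = (j + d) + 1 by ring, Function.iterate_succ_apply',
        Function.iterate_succ_apply'] at hd
      refine starf_injOn_s16 σ ?_ hn hd
      rw [← Function.iterate_succ_apply' (starf n σ)]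
      exact hi.1.trans (h _)
  obtain ⟨p, hp, q, hq, hne, heq⟩ :=
    Finset.exists_ne_map_eq_of_card_lt_of_maps_to (by simp) hmaps
  rw [Finset.mem_range] at hp hq
  rcases lt_or_gt_of_ne hne with hlt | hlt
  · refine ⟨q - p, by rw [Finset.mem_Icc]; omega, hinj p _ ?_⟩
    rw [Nat.add_sub_cancel' hlt.le]; exact heq.symm
  · refine ⟨p - q, by rw [Finset.mem_Icc]; omega, hinj q _ ?_⟩
    rw [Nat.add_sub_cancel' hlt.le]; exact heq

/-- The minima of the nontrivial cycles of `σ*`. -/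
def cycMins (n : ℕ) (σ : Equiv.Perm (Fin n)) : Finset ℕ :=
  (Finset.Icc 1 n).filter fun i => starf n σ i ≠ i ∧ ∀ m, i ≤ (starf n σ)^[m] i

lemma cycStarStat_sub_fixStarStat (n : ℕ) (σ : Equiv.Perm (Fin n)) :
    cycStarStat n σ - fixStarStat n σ = (cycMins n σ).card := by
  have hcyc : cycStarStat n σ =
      ((Finset.Icc 1 n).filter fun i => ∀ m, i ≤ (starf n σ)^[m] i).card := by
    unfold cycStarStat
    congr 1
    ext i
    simp only [mem_filter]
    refine and_congr_right fun hi => ⟨?_, fun h => ⟨exists_iterate_eq σ hi h, fun m _ => h m⟩⟩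
    rintro ⟨⟨p, hp, hpi⟩, h⟩ m
    rw [Finset.mem_Icc] at hp
    have hper : Function.IsPeriodicPt (starf n σ) p i := hpi
    rw [← hper.iterate_mod_apply m]
    have := Nat.mod_lt m (show p > 0 by omega)
    exact h _ (by rw [Finset.mem_range]; omega)
  rw [hcyc, fixStarStat, ← Finset.card_sdiff_of_subset]
  · congr 1
    ext i
    simp only [cycMins, mem_sdiff, mem_filter]
    tauto
  · intro i hi
    simp only [mem_filter] at hi ⊢
    exact ⟨hi.1, fun m => (Function.iterate_fixed hi.2 m).ge⟩

lemma cycMins_remPt {n : ℕ} {e v : Fin n} (h : (v : ℕ) = e + 1) (σ : Equiv.Perm (Fin n))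
    (hx : IsRise n σ v ∨ IsDrop n σ v) : cycMins n (remPt e v σ) = cycMins n σ := by
  have hv := v.isLt
  have hinv := starf_eq_iff σ (show 1 ≤ (v : ℕ) by omega) hv
  by_cases hfix : starf n σ v = v
  · have : remPt e v σ = σ := by
      have h3 : σ e = v := by
        apply Fin.ext; rw [← starf_succ, ← h, hfix]
      simp [remPt, h3, ← Equiv.Perm.one_def]
    rw [this]
  have ha : invstarf n σ v ≠ v := fun h' => hfix ((hinv v).2 h'.symm)
  have hx' : invstarf n σ v < v ∧ v < starf n σ v ∨ starf n σ v < v ∧ v < invstarf n σ v := by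
    unfold IsRise IsDrop at hx; omega
  ext i
  simp only [cycMins, mem_filter]
  refine and_congr_right fun hi => ?_
  by_cases hiv : i = v
  · subst hiv
    refine iff_of_false (fun h' => h'.1 (starf_remPt_self h σ)) ?_
    rintro ⟨-, hmin⟩
    obtain ⟨m, hm, hmi⟩ := exists_iterate_eq σ hi hmin
    rw [Finset.mem_Icc] at hm
    obtain ⟨m, rfl⟩ : ∃ k, m = k + 1 := ⟨m - 1, by omega⟩
    rw [Function.iterate_succ_apply', hinv] at hmi
    have h1 := hmin m
    have h2 := hmin 1
    rw [Function.iterate_one] at h2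
    omega
  · rw [← forall_le_iterate_congr hiv ha hinv (fun y hy => starf_remPt h σ hy) hx',
      starf_remPt h σ hiv]
    have := hinv i
    split_ifs with c
    · have := this.1 c
      refine and_congr_left fun _ => ?_
      omega
    · rfl

/-! ### Trading double drops for rises, one point at a time -/

/-- The contribution of the point `y`. -/
def ptWeight {R : Type*} [CommRing R] (n : ℕ) (t u s : R) (σ : Equiv.Perm (Fin n)) (y : ℕ) : R :=
  if IsVal n σ y then t else if IsRise n σ y then u else if IsDrop n σ y then s else 1

lemma sum_mul_ptWeight {R : Type*} [CommRing R] {n : ℕ} {v : ℕ} (h1 : 1 ≤ v) (h2 : v < n)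
    (t u s u' s' : R) (hus : u + s = u' + s')
    (Φ : Equiv.Perm (Fin n) → R)
    (hΦ : ∀ e w : Fin n, (w : ℕ) = e + 1 → (w : ℕ) = v → ∀ σ, IsRise n σ w ∨ IsDrop n σ w →
      Φ (remPt e w σ) = Φ σ) :
    ∑ σ, Φ σ * ptWeight n t u s σ v = ∑ σ, Φ σ * ptWeight n t u' s' σ v := by
  have key := sum_rise_eq_sum_drop (e := ⟨v - 1, by omega⟩) (v := ⟨v, h2⟩) (by simp; omega) Φ
    (hΦ _ _ (by simp; omega) rfl)
  simp only at key
  have expand : ∀ u s : R, ∑ σ, Φ σ * ptWeight n t u s σ v =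
      ∑ σ, Φ σ * ptWeight n t 0 0 σ v + (u + s) * ∑ σ with IsRise n σ v, Φ σ := by
    intro u s
    have : ∀ σ, Φ σ * ptWeight n t u s σ v = Φ σ * ptWeight n t 0 0 σ v +
        (u * (if IsRise n σ v then Φ σ else 0) + s * (if IsDrop n σ v then Φ σ else 0)) := by
      intro σ
      have a1 : IsVal n σ v → ¬ IsRise n σ v := by unfold IsVal IsRise; omega
      have a2 : IsVal n σ v → ¬ IsDrop n σ v := by unfold IsVal IsDrop; omega
      have a3 : IsRise n σ v → ¬ IsDrop n σ v := by unfold IsRise IsDrop; omega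
      unfold ptWeight
      by_cases b1 : IsVal n σ v
      · simp [b1, a1, a2]
      by_cases b2 : IsRise n σ v
      · simp [b1, b2, a3, mul_comm]
      · by_cases b3 : IsDrop n σ v <;> simp [b1, b2, b3, mul_comm]
    rw [Finset.sum_congr rfl fun σ _ => this σ, Finset.sum_add_distrib, Finset.sum_add_distrib,
      ← Finset.mul_sum, ← Finset.mul_sum, ← Finset.sum_filter, ← Finset.sum_filter, add_mul, ← key]
  rw [expand, expand u', hus]

lemma sum_ptWeight_prod {R : Type*} [CommRing R] (n : ℕ) (b t : R) (S : Finset ℕ)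
    (hS : S ⊆ Finset.Ico 1 n) :
    ∑ σ : Equiv.Perm (Fin n), b ^ (cycMins n σ).card *
        ∏ y ∈ Finset.Ico 1 n, ptWeight n t t 1 σ y =
      ∑ σ : Equiv.Perm (Fin n), b ^ (cycMins n σ).card *
        ∏ y ∈ Finset.Ico 1 n,
          if y ∈ S then ptWeight n t (1 + t) 0 σ y else ptWeight n t t 1 σ y := by
  induction S using Finset.induction_on with
  | empty => simp
  | insert x S hx ih =>
    rw [ih ((Finset.subset_insert _ _).trans hS)]
    have hxm : x ∈ Finset.Ico 1 n := hS (Finset.mem_insert_self _ _)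
    have hx12 := Finset.mem_Ico.1 hxm
    set Φ : Equiv.Perm (Fin n) → R := fun σ => b ^ (cycMins n σ).card *
      ∏ y ∈ (Finset.Ico 1 n).erase x,
          if y ∈ S then ptWeight n t (1 + t) 0 σ y else ptWeight n t t 1 σ y with hΦ
    have := sum_mul_ptWeight hx12.1 hx12.2 t t 1 (1 + t) 0 (by ring) Φ ?_
    · convert this using 2 with σ _ σ _
      · rw [← Finset.prod_erase_mul _ _ hxm, if_neg hx, hΦ, mul_assoc]
      · rw [← Finset.prod_erase_mul _ _ hxm, if_pos (Finset.mem_insert_self _ _), hΦ, mul_assoc]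
        congr 2
        refine Finset.prod_congr rfl fun y hy => ?_
        simp [Finset.ne_of_mem_erase hy]
    · intro e w hw hwx σ hσ
      simp only [hΦ]
      rw [cycMins_remPt hw σ hσ]
      congr 1
      refine Finset.prod_congr rfl fun y hy => ?_
      have hyx := Finset.ne_of_mem_erase hy
      have hy' := Finset.mem_Ico.1 (Finset.mem_of_mem_erase hy)
      obtain ⟨c1, c2, c3⟩ := types_remPt hw σ hσ hy'.1 hy'.2 (hwx ▸ hyx)
      simp only [ptWeight, c1, c2, c3]

/-! ### Evaluation of the statistics -/

lemma starf_eq_self_iff {n : ℕ} (σ : Equiv.Perm (Fin n)) {y : ℕ} (hy : y ∈ Finset.Ico 1 n) :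
    starf n σ y = y ↔ invstarf n σ y = y := by
  rw [Finset.mem_Ico] at hy
  rw [starf_eq_iff σ hy.1 hy.2, eq_comm]

lemma cvalleyStarStat_eq {n : ℕ} (σ : Equiv.Perm (Fin n)) :
    cvalleyStarStat n σ = ((Finset.Ico 1 n).filter (IsVal n σ)).card := by
  unfold cvalleyStarStat
  congr 1
  ext y
  simp only [mem_filter, Finset.mem_Icc, Finset.mem_Ico, IsVal]
  have := invstarf_self σ
  by_cases hy : y = n
  · subst hy; omega
  · omega

lemma cddStarStat_eq {n : ℕ} (σ : Equiv.Perm (Fin n)) :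
    cddStarStat n σ = ((Finset.Ico 1 n).filter (IsDrop n σ)).card := by
  unfold cddStarStat
  congr 1
  ext y
  simp only [mem_filter, Finset.mem_Icc, Finset.mem_Ico, IsDrop]
  have := invstarf_self σ
  by_cases hy : y = n
  · subst hy; omega
  · omega

lemma excStat_eq {n : ℕ} (hn : 1 ≤ n) (σ : Equiv.Perm (Fin n)) :
    excStat n σ = ((Finset.Ico 1 n).filter (IsVal n σ)).card +
      ((Finset.Ico 1 n).filter (IsRise n σ)).card := by
  have h1 : excStat n σ = ((Finset.Ico 1 n).filter fun y => y ≤ starf n σ y).card := by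
    unfold excStat
    congr 1
    ext y
    simp only [mem_filter, Finset.mem_Icc, Finset.mem_Ico]
    have := starf_lt_s16 σ hn y
    have hs : 1 ≤ y ∧ y ≤ n → starf n σ y = pext n σ y - 1 := fun h => if_pos h
    omega
  rw [h1, ← Finset.card_union_of_disjoint]
  · congr 1
    rw [← Finset.filter_or]
    refine Finset.filter_congr fun y hy => ?_
    have := starf_eq_self_iff σ hy
    unfold IsVal IsRise
    omega
  · rw [Finset.disjoint_filter]
    unfold IsVal IsRise
    intros; omega

/-- Every point is a valley, a rise, a drop or a peak, and `n` is one of the peaks, which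
outnumber the valleys by one. -/
lemma card_types {n : ℕ} (hn : 1 ≤ n) (σ : Equiv.Perm (Fin n)) :
    2 * ((Finset.Ico 1 n).filter (IsVal n σ)).card + ((Finset.Ico 1 n).filter (IsRise n σ)).card +
      ((Finset.Ico 1 n).filter (IsDrop n σ)).card = n - 1 := by
  have hA : ((Finset.Ico 1 n).filter fun y => y < invstarf n σ y).card =
      ((Finset.Ico 1 n).filter fun y => starf n σ y < y).card := by
    have hB : ((Finset.range n).filter fun y => y < invstarf n σ y).card =
        ((Finset.Icc 1 n).filter fun y => starf n σ y < y).card := by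
      refine Finset.card_nbij' (invstarf n σ) (starf n σ) ?_ ?_ ?_ ?_
      · intro y hy
        simp only [coe_filter, Finset.mem_range, Finset.mem_Icc, Set.mem_ofPred_eq] at hy ⊢
        have hi := invstarf_val σ ⟨y, hy.1⟩
        have := (σ⁻¹ ⟨y, hy.1⟩).isLt
        simp only at hi
        rw [starf_invstarf σ hy.1]
        omega
      · intro y hy
        simp only [coe_filter, Finset.mem_range, Finset.mem_Icc, Set.mem_ofPred_eq] at hy ⊢
        rw [invstarf_starf σ hy.1]
        exact ⟨starf_lt_s16 σ hn y, hy.2⟩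
      · intro y hy
        simp only [coe_filter, Finset.mem_range, Set.mem_ofPred_eq] at hy
        exact starf_invstarf σ hy.1
      · intro y hy
        simp only [coe_filter, Finset.mem_Icc, Set.mem_ofPred_eq] at hy
        exact invstarf_starf σ hy.1
    have h0 : 0 < invstarf n σ 0 := by
      rw [invstarf_val σ ⟨0, hn⟩]; omega
    rw [Finset.range_eq_Ico, ← Finset.insert_Ico_add_one_left_eq_Ico hn,
      ← Finset.Ico_insert_right hn, Finset.filter_insert, Finset.filter_insert,
      if_pos h0, if_pos (starf_lt_s16 σ hn n), Finset.card_insert_of_notMem (by simp),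
      Finset.card_insert_of_notMem (by simp)] at hB
    exact Nat.succ_injective hB
  have h1 : ((Finset.Ico 1 n).filter fun y => y < invstarf n σ y).card =
      ((Finset.Ico 1 n).filter (IsVal n σ)).card + ((Finset.Ico 1 n).filter (IsDrop n σ)).card := by
    rw [← Finset.card_union_of_disjoint, ← Finset.filter_or]
    · congr 1
      refine Finset.filter_congr fun y hy => ?_
      have := starf_eq_self_iff σ hy
      unfold IsVal IsDrop
      omega
    · rw [Finset.disjoint_filter]
      unfold IsVal IsDrop
      intros; omega
  have h2 := Finset.card_filter_add_card_filter_not (s := Finset.Ico 1 n)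
    (fun y => starf n σ y < y)
  have h3 : ((Finset.Ico 1 n).filter fun y => ¬ starf n σ y < y).card =
      ((Finset.Ico 1 n).filter (IsVal n σ)).card + ((Finset.Ico 1 n).filter (IsRise n σ)).card := by
    rw [← Finset.card_union_of_disjoint, ← Finset.filter_or]
    · congr 1
      refine Finset.filter_congr fun y hy => ?_
      have := starf_eq_self_iff σ hy
      unfold IsVal IsRise
      omega
    · rw [Finset.disjoint_filter]
      unfold IsVal IsRise
      intros; omega
  rw [Nat.card_Ico] at h2
  omega

lemma prod_ptWeight {R : Type*} [CommRing R] {n : ℕ} (t u s : R) (σ : Equiv.Perm (Fin n)) :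
    ∏ y ∈ Finset.Ico 1 n, ptWeight n t u s σ y =
      t ^ ((Finset.Ico 1 n).filter (IsVal n σ)).card *
      u ^ ((Finset.Ico 1 n).filter (IsRise n σ)).card *
      s ^ ((Finset.Ico 1 n).filter (IsDrop n σ)).card := by
  have : ∀ y, ptWeight n t u s σ y = (if IsVal n σ y then t else 1) *
      (if IsRise n σ y then u else 1) * (if IsDrop n σ y then s else 1) := by
    intro y
    have a1 : IsVal n σ y → ¬ IsRise n σ y := by unfold IsVal IsRise; omega
    have a2 : IsVal n σ y → ¬ IsDrop n σ y := by unfold IsVal IsDrop; omega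
    have a3 : IsRise n σ y → ¬ IsDrop n σ y := by unfold IsRise IsDrop; omega
    unfold ptWeight
    split_ifs <;> simp_all
  simp only [this, Finset.prod_mul_distrib, Finset.prod_ite, Finset.prod_const, one_pow, mul_one]

open MvPolynomial in
theorem statement16 (n : ℕ) (hn : 1 ≤ n) :
    (∑ σ : Equiv.Perm (Fin n),
        (X 0 : MvPolynomial (Fin 2) ℤ) ^ (cycStarStat n σ - fixStarStat n σ) *
          X 1 ^ excStat n σ) =
      ∑ k ∈ Finset.range ((n - 1) / 2 + 1),
        dPoly n k * X 1 ^ k * (1 + X 1) ^ (n - 1 - 2 * k) := by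
  have key := sum_ptWeight_prod n (X 0 : MvPolynomial (Fin 2) ℤ) (X 1) (Finset.Ico 1 n) subset_rfl
  have hL : ∀ σ : Equiv.Perm (Fin n),
      (X 0 : MvPolynomial (Fin 2) ℤ) ^ (cycStarStat n σ - fixStarStat n σ) * X 1 ^ excStat n σ =
      X 0 ^ (cycMins n σ).card * ∏ y ∈ Finset.Ico 1 n, ptWeight n (X 1) (X 1) 1 σ y := by
    intro σ
    rw [cycStarStat_sub_fixStarStat, excStat_eq hn, prod_ptWeight, one_pow, mul_one, pow_add]
  rw [Finset.sum_congr rfl fun σ _ => hL σ, key]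
  simp only [dPoly, Finset.sum_mul]
  rw [Finset.sum_congr rfl fun k _ => Finset.sum_filter _ _, Finset.sum_comm]
  refine Finset.sum_congr rfl fun σ _ => ?_
  have hc := card_types hn σ
  rw [Finset.prod_congr rfl fun y hy => if_pos hy, prod_ptWeight, ← cvalleyStarStat_eq,
    ← cddStarStat_eq, cycStarStat_sub_fixStarStat]
  rw [← cvalleyStarStat_eq, ← cddStarStat_eq] at hc
  rw [Finset.sum_eq_single (cvalleyStarStat n σ)]
  · by_cases h0 : cddStarStat n σ = 0
    · rw [if_pos ⟨rfl, h0⟩, h0, pow_zero, mul_one, ← mul_assoc]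
      congr 2
      omega
    · rw [if_neg (fun h => h0 h.2), zero_pow h0, mul_zero, mul_zero]
  · intro k _ hk
    exact if_neg fun h => hk h.1.symm
  · intro h
    rw [Finset.mem_range] at h
    omega

end SZpaper
end
end
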